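/- arXiv:1209.1667 — 4 statements merged into one kernel-verified Lean document; each statement's English description precedes it below -/
import Mathlib

section
/- For every integer m ≥ 1 and every function α : ℤ/mℤ → ℝ, the sets H₁(α) and H₂(α) are subgroups of ℤ/mℤ with H₂(α) ⊆ H₁(α), the quotient group H₁(α)/H₂(α) has at most two elements, and if m is odd then H₁(α) = H₂(α). -/
/-- The subgroup of periods of a function on an additive commutative group. -/
def periodSubgroup {G β : Type*} [AddCommGroup G] (f : G → β) : AddSubgroup G where
  carrier := {j | ∀ i, f (i + j) = f i}
  zero_mem' i := by rw [add_zero]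
  add_mem' {a b} ha hb i := by rw [← add_assoc, hb, ha]
  neg_mem' {a} ha i := by rw [← ha (i + -a), neg_add_cancel_right]

theorem two_nsmul_mem_periodSubgroup_iff {G β : Type*} [AddCommGroup G] (f : G → β) (j : G) :
    2 • j ∈ periodSubgroup f ↔ ∀ i, f (i + j) = f (i - j) := by
  constructor
  · intro h i
    rw [← h (i - j)]
    congr 1
    abel
  · intro h i
    have := h (i + j)
    rwa [add_sub_cancel_right, add_assoc, ← two_nsmul] at this

theorem IsAddCyclic.card_le_of_forall_nsmul_eq_zero {G : Type*} [AddGroup G] [IsAddCyclic G]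
    {n : ℕ} (hn : 0 < n) (h : ∀ g : G, n • g = 0) : Nat.card G ≤ n := by
  rw [← IsAddCyclic.exponent_eq_card]
  exact Nat.le_of_dvd hn (AddMonoid.exponent_dvd_of_forall_nsmul_eq_zero h)


/-- For every integer `m ≥ 1` and every function `α : ℤ/mℤ → ℝ`,
the sets `H₁(α) = {j | ∀ i, α (i+j) = α (i-j)}` and `H₂(α) = {j | ∀ i, α (i+j) = α i}`
are subgroups of `ℤ/mℤ` with `H₂ ⊆ H₁`, the quotient `H₁/H₂` has at most two elements,
and if `m` is odd then `H₁ = H₂`. -/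
theorem stmt_0 (m : ℕ) (hm : 1 ≤ m) (α : ZMod m → ℝ) :
    ∃ H₁ H₂ : AddSubgroup (ZMod m),
      (H₁ : Set (ZMod m)) = {j | ∀ i, α (i + j) = α (i - j)} ∧
      (H₂ : Set (ZMod m)) = {j | ∀ i, α (i + j) = α i} ∧
      H₂ ≤ H₁ ∧
      Nat.card (↥H₁ ⧸ H₂.addSubgroupOf H₁) ≤ 2 ∧
      (Odd m → H₁ = H₂) := by
  refine ⟨(periodSubgroup α).comap (nsmulAddMonoidHom 2), periodSubgroup α, ?_, rfl, ?_, ?_, ?_⟩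
  · ext j
    exact two_nsmul_mem_periodSubgroup_iff α j
  · exact fun j hj => AddSubgroup.nsmul_mem _ hj 2
  · have := isAddCyclic_of_surjective
      (QuotientAddGroup.mk' ((periodSubgroup α).addSubgroupOf
        ((periodSubgroup α).comap (nsmulAddMonoidHom 2))))
      (QuotientAddGroup.mk'_surjective _)
    refine IsAddCyclic.card_le_of_forall_nsmul_eq_zero two_pos fun g => ?_
    obtain ⟨x, rfl⟩ := QuotientAddGroup.mk_surjective g
    rw [← QuotientAddGroup.mk_nsmul, QuotientAddGroup.eq_zero_iff]
    exact x.2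
  · rintro ⟨k, hk⟩
    refine le_antisymm (fun j hj => ?_) fun j hj => AddSubgroup.nsmul_mem _ hj 2
    have hj' : j = -(k • 2 • j) := by
      have hmj : (2 * k + 1) • j = 0 := by
        rw [← hk, nsmul_eq_mul, ZMod.natCast_self, zero_mul]
      rw [add_nsmul, one_nsmul, mul_comm, mul_nsmul'] at hmj
      exact eq_neg_of_add_eq_zero_right hmj
    rw [hj']
    exact neg_mem (AddSubgroup.nsmul_mem _ (AddSubgroup.mem_comap.mp hj) k)
end

section
/- Let m ≥ 1 be an integer, c ∈ ℤ/mℤ, and α : ℤ/mℤ → ℝ a function with α(c−i) = α(i) for all i ∈ ℤ/mℤ. Let S := {s ∈ ℤ/mℤ : α(c−i+s) = α(i+s) for all i ∈ ℤ/mℤ}. Then the set of functions { (i ↦ α(i+s)) : s ∈ S } has at most two elements. (This is the combinatorial content of the statement that, for arbitrary m, at most two simplicial types are possible for a reflection-fixed point with prescribed barycentric coordinates up to rotation of the Coxeter diagram of type Ã_{m−1}.) -/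
/-- The subgroup of elements `s` such that `2s` is a period of `α`. -/
def halfPeriods {A B : Type*} [AddCommGroup A] (α : A → B) : AddSubgroup A where
  carrier := {s | ∀ i, α (i + (s + s)) = α i}
  zero_mem' := by simp
  add_mem' {a b} ha hb i := by
    rw [← ha i, ← hb (i + (a + a))]
    congr 1
    abel
  neg_mem' {a} ha i := by
    rw [← ha (i + (-a + -a))]
    congr 1
    abel

/-- In a cyclic group, shifting a function by elements whose doubles are periods gives at most
two functions. -/
theorem exists_shift_eq_of_mem_halfPeriods {A B : Type*} [AddCommGroup A] [IsAddCyclic A]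
    (α : A → B) :
    ∃ g : A, ∀ s ∈ halfPeriods α,
      (fun i => α (i + s)) = α ∨ (fun i => α (i + s)) = fun i => α (i + g) := by
  obtain ⟨⟨g, hg⟩, hgen⟩ := IsAddCyclic.exists_generator (α := halfPeriods α)
  have hper (k : ℤ) (i : A) : α (i + (k • g + k • g)) = α i :=
    (halfPeriods α).zsmul_mem hg k i
  refine ⟨g, fun s hs => ?_⟩
  obtain ⟨n, hn⟩ := AddSubgroup.mem_zmultiples_iff.mp (hgen ⟨s, hs⟩)
  have hns : n • g = s := congrArg Subtype.val hn
  subst hns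
  obtain ⟨k, rfl | rfl⟩ := n.even_or_odd'
  · left
    funext i
    rw [← hper k i, two_mul, add_zsmul]
  · right
    funext i
    rw [← hper k (i + g), two_mul, add_zsmul, add_zsmul, one_zsmul]
    congr 1
    abel


/-- Let `m ≥ 1`, `c ∈ ℤ/mℤ`, and `α : ℤ/mℤ → ℝ` invariant under the
reflection `i ↦ c - i`.  Then among all shifts of `α` by elements `s` such that the
shifted function is again invariant under this reflection, at most two distinct
functions occur.  (At most two simplicial types are possible for a reflection-fixed
point with prescribed barycentric coordinates up to rotation of the Coxeter diagram of
type `Ã_{m-1}`.) -/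
theorem stmt_2 (m : ℕ) (hm : 1 ≤ m) (c : ZMod m) (α : ZMod m → ℝ)
    (hα : ∀ i, α (c - i) = α i) :
    {g : ZMod m → ℝ | ∃ s : ZMod m,
        (∀ i, α (c - i + s) = α (i + s)) ∧ g = fun i => α (i + s)}.ncard ≤ 2 := by
  obtain ⟨g, hg⟩ := exists_shift_eq_of_mem_halfPeriods α
  refine (Set.ncard_le_ncard (t := {α, fun i => α (i + g)}) ?_ (Set.toFinite _)).trans
    ((Set.ncard_insert_le _ _).trans (by simp))
  rintro _ ⟨s, hs, rfl⟩
  refine hg s fun i => ?_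
  have h := hs (c - i - s)
  rw [show c - (c - i - s) + s = i + (s + s) by abel, sub_add_cancel, hα] at h
  exact h
end

section
/- Let E|k be a finite extension of non-Archimedean local fields. If E|k is normal, or if E is k-algebra isomorphic to T ⊗_k L for some totally ramified finite extension T|k and some unramified finite extension L|k, then the Frobenius automorphism of the maximal unramified subextension E_ur|k extends to a k-algebra automorphism of E (i.e. E|k satisfies the strong extension property). -/
noncomputable section

/-- Axioms expressing that `ν : K → EReal` is the additive valuation of a
non-Archimedean local (skew) field structure on `K`, normalized relatively to a base
field with valuation group `ℤ`, so that the value group of `K` is `(1/e)ℤ`; `K` is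
complete and its residue field has exactly `q` elements (encoded by a complete finite
set of residue representatives). -/
structure IsLocalValuation (K : Type*) [DivisionRing K] (ν : K → EReal) (e q : ℕ) : Prop where
  e_pos : 0 < e
  one_lt_q : 1 < q
  eq_top_iff : ∀ x : K, ν x = ⊤ ↔ x = 0
  map_mul : ∀ x y : K, ν (x * y) = ν x + ν y
  min_le_add : ∀ x y : K, min (ν x) (ν y) ≤ ν (x + y)
  values : ∀ x : K, x ≠ 0 → ∃ m : ℤ, ν x = ((m / e : ℝ) : EReal)
  exists_uniformizer : ∃ π : K, ν π = (((e : ℝ)⁻¹ : ℝ) : EReal)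
  complete : ∀ x : ℕ → K,
      (∀ M : ℝ, ∃ N : ℕ, ∀ m ≥ N, ∀ n ≥ N, (M : EReal) ≤ ν (x m - x n)) →
      ∃ l : K, ∀ M : ℝ, ∃ N : ℕ, ∀ n ≥ N, (M : EReal) ≤ ν (x n - l)
  residue : ∃ s : Finset K, s.card = q ∧ (∀ y ∈ s, 0 ≤ ν y) ∧
      ∀ x : K, 0 ≤ ν x → ∃! y, y ∈ s ∧ 0 < ν (x - y)

namespace IsLocalValuation

variable {K : Type*} [Field K] {ν : K → EReal} {e q : ℕ}

lemma map_zero (h : IsLocalValuation K ν e q) : ν 0 = ⊤ := (h.eq_top_iff 0).2 rfl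

lemma exists_real (h : IsLocalValuation K ν e q) {x : K} (hx : x ≠ 0) :
    ∃ r : ℝ, ν x = (r : EReal) := by
  obtain ⟨m, hm⟩ := h.values x hx
  exact ⟨_, hm⟩

lemma map_one (h : IsLocalValuation K ν e q) : ν 1 = 0 := by
  obtain ⟨r, hr⟩ := h.exists_real (one_ne_zero (α := K))
  have h1 := h.map_mul 1 1
  rw [mul_one, hr, ← EReal.coe_add, EReal.coe_eq_coe_iff] at h1
  rw [hr, show r = 0 by linarith, EReal.coe_zero]

lemma map_neg (h : IsLocalValuation K ν e q) (x : K) : ν (-x) = ν x := by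
  have h1 : ν (-1) = 0 := by
    obtain ⟨r, hr⟩ := h.exists_real (neg_ne_zero.2 (one_ne_zero (α := K)))
    have h2 := h.map_mul (-1) (-1)
    rw [neg_mul_neg, mul_one, h.map_one, hr, ← EReal.coe_add, ← EReal.coe_zero,
      EReal.coe_eq_coe_iff] at h2
    rw [hr, show r = 0 by linarith, EReal.coe_zero]
  rw [← neg_one_mul, h.map_mul, h1, zero_add]

lemma le_add (h : IsLocalValuation K ν e q) {c : EReal} {x y : K} (hx : c ≤ ν x) (hy : c ≤ ν y) :
    c ≤ ν (x + y) := (le_min hx hy).trans (h.min_le_add x y)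

lemma lt_add (h : IsLocalValuation K ν e q) {c : EReal} {x y : K} (hx : c < ν x) (hy : c < ν y) :
    c < ν (x + y) := (lt_min hx hy).trans_le (h.min_le_add x y)

lemma le_sub (h : IsLocalValuation K ν e q) {c : EReal} {x y : K} (hx : c ≤ ν x) (hy : c ≤ ν y) :
    c ≤ ν (x - y) := by
  rw [sub_eq_add_neg]
  exact h.le_add hx (by rwa [h.map_neg])

lemma sub_comm (h : IsLocalValuation K ν e q) (x y : K) : ν (x - y) = ν (y - x) := by
  rw [← neg_sub, h.map_neg]

lemma le_sum (h : IsLocalValuation K ν e q) {ι : Type*} (s : Finset ι) {c : EReal} {g : ι → K}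
    (hg : ∀ i ∈ s, c ≤ ν (g i)) : c ≤ ν (∑ i ∈ s, g i) := by
  classical
  induction s using Finset.induction_on with
  | empty => simp [h.map_zero]
  | insert a s ha ih =>
    rw [Finset.sum_insert ha]
    exact h.le_add (hg a (by simp)) (ih fun i hi => hg i (by simp [hi]))

lemma le_mul (h : IsLocalValuation K ν e q) {a b : ℝ} {x y : K} (hx : (a : EReal) ≤ ν x)
    (hy : (b : EReal) ≤ ν y) : ((a + b : ℝ) : EReal) ≤ ν (x * y) := by
  rw [h.map_mul, EReal.coe_add]
  exact add_le_add hx hy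

lemma map_inv (h : IsLocalValuation K ν e q) {x : K} {r : ℝ} (hr : ν x = (r : EReal)) :
    ν x⁻¹ = ((-r : ℝ) : EReal) := by
  have hx : x ≠ 0 := by
    rintro rfl
    rw [h.map_zero] at hr
    exact EReal.coe_ne_top _ hr.symm
  obtain ⟨s, hs⟩ := h.exists_real (inv_ne_zero hx)
  have h2 := h.map_mul x x⁻¹
  rw [mul_inv_cancel₀ hx, h.map_one, hr, hs, ← EReal.coe_add, ← EReal.coe_zero,
    EReal.coe_eq_coe_iff] at h2
  rw [hs, show s = -r by linarith]

lemma map_pow (h : IsLocalValuation K ν e q) {x : K} {r : ℝ} (hr : ν x = (r : EReal)) (n : ℕ) :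
    ν (x ^ n) = ((n * r : ℝ) : EReal) := by
  induction n with
  | zero => simp [h.map_one]
  | succ n ih =>
    rw [pow_succ, h.map_mul, ih, hr, ← EReal.coe_add]
    congr 1
    push_cast
    ring

lemma eq_zero_of_forall_le (h : IsLocalValuation K ν e q) {x : K}
    (hx : ∀ n : ℕ, (((n : ℝ)) : EReal) ≤ ν x) : x = 0 := by
  by_contra h0
  obtain ⟨r, hr⟩ := h.exists_real h0
  obtain ⟨n, hn⟩ := exists_nat_gt r
  have := hx n
  rw [hr, EReal.coe_le_coe_iff] at this
  linarith

/-- The valuation ring of a local valuation. -/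
def integers (h : IsLocalValuation K ν e q) : ValuationSubring K where
  carrier := {x | 0 ≤ ν x}
  mul_mem' {x y} hx hy := by
    have := h.le_mul (a := 0) (b := 0) hx hy
    simpa using this
  one_mem' := h.map_one.ge
  add_mem' hx hy := h.le_add hx hy
  zero_mem' := by simp [h.map_zero]
  neg_mem' {x} hx := by
    change 0 ≤ ν (-x)
    rwa [h.map_neg]
  mem_or_inv_mem' x := by
    change 0 ≤ ν x ∨ 0 ≤ ν x⁻¹
    by_cases hx : x = 0
    · left; simp [hx, h.map_zero]
    · obtain ⟨r, hr⟩ := h.exists_real hx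
      rw [h.map_inv hr, hr]
      simp only [EReal.coe_nonneg]
      rcases le_total 0 r with h | h
      · exact Or.inl h
      · exact Or.inr (by linarith)

@[simp] lemma mem_integers (h : IsLocalValuation K ν e q) {x : K} :
    x ∈ h.integers ↔ 0 ≤ ν x := Iff.rfl

lemma residue_eq_zero_iff (h : IsLocalValuation K ν e q) (x : h.integers) :
    IsLocalRing.residue h.integers x = 0 ↔ 0 < ν x := by
  rw [IsLocalRing.residue_eq_zero_iff, IsLocalRing.mem_maximalIdeal, mem_nonunits_iff]
  have hx : 0 ≤ ν x := x.2
  constructor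
  · intro hu
    refine lt_of_le_of_ne hx fun h0 => hu ?_
    have h1 : ν (x : K)⁻¹ = 0 := by
      simpa using h.map_inv (r := 0) (by simpa using h0.symm)
    have hne : (x : K) ≠ 0 := by
      intro hx0
      rw [hx0, h.map_zero] at h0
      simp at h0
    exact IsUnit.of_mul_eq_one ⟨(x : K)⁻¹, h1.ge⟩ (Subtype.ext (mul_inv_cancel₀ hne))
  · intro hlt hu
    obtain ⟨y, hy⟩ := hu.exists_right_inv
    have h2 : (x : K) * y = 1 := congrArg Subtype.val hy
    have h3 := h.map_mul x y
    rw [h2, h.map_one] at h3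
    have h4 : 0 ≤ ν y := y.2
    have := add_pos_of_pos_of_nonneg hlt h4
    exact this.ne h3

lemma residue_eq_iff (h : IsLocalValuation K ν e q) (x y : h.integers) :
    IsLocalRing.residue h.integers x = IsLocalRing.residue h.integers y ↔ 0 < ν (x - y : K) := by
  rw [← sub_eq_zero, ← _root_.map_sub, residue_eq_zero_iff]
  rfl

lemma natCard_residueField (h : IsLocalValuation K ν e q) :
    Nat.card (IsLocalRing.ResidueField h.integers) = q := by
  obtain ⟨s, hs, hpos, huniq⟩ := h.residue
  have hbij : Function.Bijective fun y : s =>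
      IsLocalRing.residue h.integers ⟨y, hpos y y.2⟩ := by
    constructor
    · intro y z hyz
      have h1 := (h.residue_eq_iff _ _).1 hyz
      have h2 := huniq y (hpos y y.2)
      exact Subtype.ext (h2.unique ⟨y.2, by simp [h.map_zero]⟩ ⟨z.2, h1⟩)
    · intro c
      obtain ⟨x, rfl⟩ := IsLocalRing.residue_surjective c
      obtain ⟨y, ⟨hy, hxy⟩, -⟩ := huniq x x.2
      exact ⟨⟨y, hy⟩, ((h.residue_eq_iff _ _).2 hxy).symm⟩
  rw [← Nat.card_congr (Equiv.ofBijective _ hbij), Nat.card_eq_fintype_card, Fintype.card_coe, hs]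

lemma finite_residueField (h : IsLocalValuation K ν e q) :
    Finite (IsLocalRing.ResidueField h.integers) :=
  Nat.finite_of_card_ne_zero (by
    rw [h.natCard_residueField]
    have := h.one_lt_q
    omega)

/-- An element of positive valuation has valuation at least `1 / e`. -/
lemma inv_le_of_pos (h : IsLocalValuation K ν e q) {x : K} (hx : 0 < ν x) :
    (((e : ℝ)⁻¹ : ℝ) : EReal) ≤ ν x := by
  by_cases h0 : x = 0
  · simp [h0, h.map_zero]
  obtain ⟨m, hm⟩ := h.values x h0
  have he : (0 : ℝ) < e := by exact_mod_cast h.e_pos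
  rw [hm] at hx ⊢
  rw [EReal.coe_pos] at hx
  rw [EReal.coe_le_coe_iff, inv_eq_one_div, div_le_div_iff_of_pos_right he]
  have : (0 : ℝ) < m := by simpa using (div_pos_iff_of_pos_right he).1 hx
  have h1 : 0 < m := by exact_mod_cast this
  exact_mod_cast h1

end IsLocalValuation

namespace IsLocalValuation

section Teichmuller

variable {K : Type*} [Field K] {ν : K → EReal} {e q : ℕ}

lemma pow_card_sub_pos (h : IsLocalValuation K ν e q) {x : K} (hx : 0 ≤ ν x) :
    0 < ν (x ^ q - x) := by
  have := h.finite_residueField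
  have := Fintype.ofFinite (IsLocalRing.ResidueField h.integers)
  have h1 := FiniteField.pow_card (IsLocalRing.residue h.integers ⟨x, hx⟩)
  rw [← Nat.card_eq_fintype_card, h.natCard_residueField, ← _root_.map_pow,
    h.residue_eq_iff] at h1
  exact h1

lemma nonneg_sub (h : IsLocalValuation K ν e q) {x y : K} (hy : 0 ≤ ν y) (hxy : 0 ≤ ν (x - y)) :
    0 ≤ ν x := by
  simpa using h.le_add hxy hy

lemma le_pow_card_sub_pow_card (h : IsLocalValuation K ν e q) {a b : K} (ha : 0 ≤ ν a)
    (hb : 0 ≤ ν b) {m : ℕ} (hab : (((m + 1) / e : ℝ) : EReal) ≤ ν (a - b)) :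
    (((m + 1 + 1) / e : ℝ) : EReal) ≤ ν (a ^ q - b ^ q) := by
  have he : (0 : ℝ) < e := by exact_mod_cast h.e_pos
  have hpos : 0 < ν (∑ i ∈ Finset.range q, a ^ i * b ^ (q - 1 - i)) := by
    have := h.finite_residueField
    have := Fintype.ofFinite (IsLocalRing.ResidueField h.integers)
    have hr : IsLocalRing.residue h.integers ⟨a, ha⟩ = IsLocalRing.residue h.integers ⟨b, hb⟩ :=
      (h.residue_eq_iff _ _).2 (lt_of_lt_of_le (by rw [EReal.coe_pos]; positivity) hab)
    have h0 : IsLocalRing.residue h.integers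
        (∑ i ∈ Finset.range q, ⟨a, ha⟩ ^ i * ⟨b, hb⟩ ^ (q - 1 - i)) = 0 := by
      rw [_root_.map_sum]
      simp only [_root_.map_mul, _root_.map_pow, hr]
      rw [geom_sum₂_self]
      have := FiniteField.cast_card_eq_zero (IsLocalRing.ResidueField h.integers)
      rw [← Nat.card_eq_fintype_card, h.natCard_residueField] at this
      rw [this, zero_mul]
    rw [h.residue_eq_zero_iff] at h0
    simpa using h0
  rw [← geom_sum₂_mul, show ((m + 1 + 1) / e : ℝ) = (e : ℝ)⁻¹ + (m + 1) / e by field_simp; ring]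
  exact h.le_mul (h.inv_le_of_pos hpos) hab

lemma nonneg_of_pow_card_eq (h : IsLocalValuation K ν e q) {x : K} (hx : x ^ q = x) :
    0 ≤ ν x := by
  by_cases h0 : x = 0
  · simp [h0, h.map_zero]
  obtain ⟨r, hr⟩ := h.exists_real h0
  have h1 := h.map_pow hr q
  have hq : (1 : ℝ) < q := by exact_mod_cast h.one_lt_q
  rw [hx, hr, EReal.coe_eq_coe_iff] at h1
  have : (q - 1) * r = 0 := by linarith
  rcases mul_eq_zero.1 this with h2 | h2
  · linarith
  · rw [hr, h2]; simp

lemma eq_of_pow_card_eq (h : IsLocalValuation K ν e q) {x y : K} (hx : x ^ q = x) (hy : y ^ q = y)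
    (hxy : 0 < ν (x - y)) : x = y := by
  have he : (0 : ℝ) < e := by exact_mod_cast h.e_pos
  have key : ∀ m : ℕ, (((m + 1) / e : ℝ) : EReal) ≤ ν (x - y) := by
    intro m
    induction m with
    | zero => simpa using h.inv_le_of_pos hxy
    | succ m ih =>
      have := h.le_pow_card_sub_pow_card (h.nonneg_of_pow_card_eq hx)
        (h.nonneg_of_pow_card_eq hy) ih
      rw [hx, hy] at this
      push_cast
      exact this
  rw [← sub_eq_zero]
  refine h.eq_zero_of_forall_le fun n => le_trans ?_ (key (n * e))
  rw [EReal.coe_le_coe_iff, le_div_iff₀ he]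
  push_cast
  linarith

/-- Every integral element is congruent to a Teichmüller representative, which is a limit of
powers of the element. -/
lemma exists_teichmuller (h : IsLocalValuation K ν e q) {y : K} (hy : 0 ≤ ν y) :
    ∃ ζ : K, ζ ^ q = ζ ∧ 0 < ν (y - ζ) ∧ ∀ N : ℕ, ∃ n : ℕ, (N : ℝ) ≤ ν (ζ - y ^ n) := by
  have he : (0 : ℝ) < e := by exact_mod_cast h.e_pos
  have hint : ∀ n : ℕ, 0 ≤ ν (y ^ n) := fun n =>
    (h.mem_integers).1 (pow_mem (h.mem_integers.2 hy) n)
  have hstep : ∀ n : ℕ, (((n + 1) / e : ℝ) : EReal) ≤ ν (y ^ q ^ (n + 1) - y ^ q ^ n) := by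
    intro n
    induction n with
    | zero => simpa using h.inv_le_of_pos (h.pow_card_sub_pos hy)
    | succ n ih =>
      have := h.le_pow_card_sub_pow_card (hint _) (hint _) ih
      rw [← pow_mul, ← pow_mul, ← pow_succ, ← pow_succ] at this
      push_cast
      exact this
  have htail : ∀ N n : ℕ, N ≤ n → (((N + 1) / e : ℝ) : EReal) ≤ ν (y ^ q ^ n - y ^ q ^ N) := by
    intro N n hn
    induction n, hn using Nat.le_induction with
    | base => simp [h.map_zero]
    | succ n hn ih =>
      rw [← sub_add_sub_cancel _ (y ^ q ^ n)]
      refine h.le_add (le_trans ?_ (hstep n)) ih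
      rw [EReal.coe_le_coe_iff]
      gcongr
  obtain ⟨ζ, hζ⟩ := h.complete (fun n => y ^ q ^ n) (by
    intro M
    obtain ⟨N, hN⟩ := exists_nat_gt (M * e)
    have hM : (M : EReal) ≤ (((N + 1) / e : ℝ) : EReal) := by
      rw [EReal.coe_le_coe_iff, le_div_iff₀ he]
      linarith
    refine ⟨N, fun m hm n hn => ?_⟩
    rw [← sub_sub_sub_cancel_right _ _ (y ^ q ^ N)]
    exact h.le_sub (hM.trans (htail N m hm)) (hM.trans (htail N n hn)))
  have hpos : 0 < ν (y - ζ) := by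
    obtain ⟨N, hN⟩ := hζ 1
    rw [← sub_add_sub_cancel _ (y ^ q ^ N)]
    refine h.lt_add ?_ (lt_of_lt_of_le (by norm_num) (hN N le_rfl))
    rw [h.sub_comm]
    have := htail 0 N (Nat.zero_le _)
    simp only [pow_zero, pow_one] at this
    refine lt_of_lt_of_le ?_ this
    rw [EReal.coe_pos]
    positivity
  have hζint : 0 ≤ ν ζ := h.nonneg_sub hy (by rw [h.sub_comm]; exact hpos.le)
  refine ⟨ζ, ?_, hpos, fun N => ?_⟩
  · rw [← sub_eq_zero]
    refine h.eq_zero_of_forall_le fun n => ?_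
    obtain ⟨N, hN⟩ := hζ (max n 1)
    rw [← sub_add_sub_cancel _ ((y ^ q ^ N) ^ q)]
    refine h.le_add ?_ ?_
    · have h1 : 0 ≤ ν (∑ i ∈ Finset.range q, ζ ^ i * (y ^ q ^ N) ^ (q - 1 - i)) :=
        h.le_sum _ fun i _ => h.mem_integers.1
          (mul_mem (pow_mem (h.mem_integers.2 hζint) _) (pow_mem (h.mem_integers.2 (hint _)) _))
      have h2 := hN N le_rfl
      rw [h.sub_comm] at h2
      have h3 := h.le_mul (a := 0) (by simpa using h1) h2
      rw [← geom_sum₂_mul]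
      refine le_trans ?_ h3
      rw [EReal.coe_le_coe_iff]
      simp
    · rw [← pow_mul, ← pow_succ]
      refine le_trans ?_ (hN (N + 1) (by omega))
      rw [EReal.coe_le_coe_iff]
      simp
  · obtain ⟨n, hn⟩ := hζ N
    exact ⟨q ^ n, by rw [h.sub_comm]; exact hn n le_rfl⟩

end Teichmuller

section Extension

variable {k E : Type*} [Field k] [Field E] [Algebra k E] {νk : k → EReal} {νE : E → EReal}
  {e q qE : ℕ}

lemma exists_map_eq_one (hk : IsLocalValuation k νk 1 q) :
    ∃ π : k, νk π = ((1 : ℝ) : EReal) := by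
  simpa using hk.exists_uniformizer

/-- Successive approximation: if every element of a set of integral elements is an integral
combination of `w` modulo `π` times the set, then it is an integral combination of `w`. -/
lemma exists_sum_eq_of_approx (hk : IsLocalValuation k νk 1 q) (hE : IsLocalValuation E νE e qE)
    (hcompat : ∀ c : k, νE (algebraMap k E c) = νk c) {ι : Type*} [Fintype ι] {w : ι → E}
    (hw : ∀ i, 0 ≤ νE (w i)) {π : k} (hπ : νk π = ((1 : ℝ) : EReal)) {S : Set E}
    (hS : ∀ x ∈ S, 0 ≤ νE x)
    (step : ∀ x ∈ S, ∃ a : ι → k, (∀ i, 0 ≤ νk (a i)) ∧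
      ∃ x' ∈ S, x = ∑ i, algebraMap k E (a i) * w i + algebraMap k E π * x')
    {x : E} (hx : x ∈ S) :
    ∃ a : ι → k, (∀ i, 0 ≤ νk (a i)) ∧ x = ∑ i, algebraMap k E (a i) * w i := by
  choose a ha nxt hnxt heq using step
  let X : ℕ → S := fun n => (fun y : S => ⟨nxt y y.2, hnxt y y.2⟩)^[n] ⟨x, hx⟩
  let b : ℕ → ι → k := fun n => a (X n) (X n).2
  have hb : ∀ n i, 0 ≤ νk (b n i) := fun n => ha _ _
  have hX : ∀ n, (X n : E) = ∑ i, algebraMap k E (b n i) * w i + algebraMap k E π * X (n + 1) := by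
    intro n
    have h1 : (X (n + 1) : E) = nxt (X n) (X n).2 := by
      simp only [X, Function.iterate_succ_apply']
    rw [h1]
    exact heq _ _
  let A : ℕ → ι → k := fun n i => ∑ j ∈ Finset.range n, π ^ j * b j i
  have hA : ∀ n, x = ∑ i, algebraMap k E (A n i) * w i + algebraMap k E π ^ n * X n := by
    intro n
    induction n with
    | zero => simp [A, X]
    | succ n ih =>
      have h2 : ∑ i, algebraMap k E (A (n + 1) i) * w i = ∑ i, algebraMap k E (A n i) * w i
          + algebraMap k E π ^ n * ∑ i, algebraMap k E (b n i) * w i := by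
        rw [Finset.mul_sum, ← Finset.sum_add_distrib]
        refine Finset.sum_congr rfl fun i _ => ?_
        simp only [A, Finset.sum_range_succ, _root_.map_add, _root_.map_mul, _root_.map_pow]
        ring
      rw [h2]
      conv_lhs => rw [ih, hX n]
      ring
  have htail : ∀ N n : ℕ, N ≤ n → ∀ i, ((N : ℝ) : EReal) ≤ νk (A n i - A N i) := by
    intro N n hn i
    have h3 : A n i - A N i = ∑ j ∈ Finset.Ico N n, π ^ j * b j i := by
      rw [Finset.sum_Ico_eq_sub _ hn]
    rw [h3]
    refine hk.le_sum _ fun j hj => ?_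
    have h4 := hk.le_mul (hk.map_pow hπ j).ge (b := 0) (by simpa using hb j i)
    refine le_trans ?_ h4
    rw [EReal.coe_le_coe_iff]
    simpa using (Finset.mem_Ico.1 hj).1
  have hlim : ∀ i, ∃ l : k, ∀ M : ℝ, ∃ N : ℕ, ∀ n ≥ N, (M : EReal) ≤ νk (A n i - l) := by
    intro i
    refine hk.complete (fun n => A n i) fun M => ?_
    obtain ⟨N, hN⟩ := exists_nat_gt M
    have hM : (M : EReal) ≤ ((N : ℝ) : EReal) := by
      rw [EReal.coe_le_coe_iff]
      exact hN.le
    refine ⟨N, fun m hm n hn => ?_⟩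
    rw [← sub_sub_sub_cancel_right _ _ (A N i)]
    exact hk.le_sub (hM.trans (htail N m hm i)) (hM.trans (htail N n hn i))
  choose l hl using hlim
  have hl' : ∀ (n : ℕ) i, ((n : ℝ) : EReal) ≤ νk (A n i - l i) := by
    intro n i
    obtain ⟨N, hN⟩ := hl i n
    rw [← sub_add_sub_cancel _ (A (max n N) i)]
    refine hk.le_add ?_ (hN _ (le_max_right _ _))
    rw [hk.sub_comm]
    exact htail n _ (le_max_left _ _) i
  refine ⟨l, fun i => ?_, ?_⟩
  · have := hl' 0 i
    simpa [A, hk.map_neg] using this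
  · rw [← sub_eq_zero]
    refine hE.eq_zero_of_forall_le fun n => ?_
    have h5 : x - ∑ i, algebraMap k E (l i) * w i
        = ∑ i, algebraMap k E (A n i - l i) * w i + algebraMap k E π ^ n * X n := by
      conv_lhs => rw [hA n]
      simp only [_root_.map_sub, sub_mul, Finset.sum_sub_distrib]
      ring
    rw [h5]
    refine hE.le_add (hE.le_sum _ fun i _ => ?_) ?_
    · have := hE.le_mul (a := n) (b := 0) (x := algebraMap k E (A n i - l i)) (y := w i)
        (by rw [hcompat]; exact hl' n i) (by simpa using hw i)
      simpa using this
    · have hπE : νE (algebraMap k E π) = ((1 : ℝ) : EReal) := by rw [hcompat, hπ]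
      have := hE.le_mul (hE.map_pow hπE n).ge (b := 0) (by simpa using hS _ (X n).2)
      simpa using this

end Extension

end IsLocalValuation

namespace IsLocalValuation

section Unramified

variable {k E : Type*} [Field k] [Field E] [Algebra k E] {νk : k → EReal} {νE : E → EReal}
  {e q qE : ℕ}

lemma exists_sum_eq_of_residue (hk : IsLocalValuation k νk 1 q) (hE : IsLocalValuation E νE e qE)
    (hcompat : ∀ c : k, νE (algebraMap k E c) = νk c) (F : IntermediateField k E)
    (hF : ∀ x : F, (x : E) ≠ 0 → ∃ m : ℤ, νE (x : E) = ((m : ℝ) : EReal))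
    {ι : Type*} [Fintype ι] {w : ι → E} (hwF : ∀ i, w i ∈ F) (hw : ∀ i, 0 ≤ νE (w i))
    (hres : ∀ x ∈ F, 0 ≤ νE x → ∃ a : ι → k, (∀ i, 0 ≤ νk (a i)) ∧
      0 < νE (x - ∑ i, algebraMap k E (a i) * w i))
    {x : E} (hxF : x ∈ F) (hx : 0 ≤ νE x) :
    ∃ a : ι → k, (∀ i, 0 ≤ νk (a i)) ∧ x = ∑ i, algebraMap k E (a i) * w i := by
  obtain ⟨π, hπ⟩ := hk.exists_map_eq_one
  refine hk.exists_sum_eq_of_approx hE hcompat hw hπ (S := {x | x ∈ F ∧ 0 ≤ νE x})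
    (fun x hx => hx.2) ?_ ⟨hxF, hx⟩
  rintro x ⟨hxF, hx⟩
  obtain ⟨a, ha, hpos⟩ := hres x hxF hx
  have hπE : νE (algebraMap k E π) = ((1 : ℝ) : EReal) := by rw [hcompat, hπ]
  have hπ0 : algebraMap k E π ≠ 0 := by
    intro h0
    rw [h0, hE.map_zero] at hπE
    exact EReal.coe_ne_top _ hπE.symm
  have hdF : x - ∑ i, algebraMap k E (a i) * w i ∈ F :=
    sub_mem hxF (sum_mem fun i _ => mul_mem (F.algebraMap_mem _) (hwF i))
  refine ⟨a, ha, (algebraMap k E π)⁻¹ * (x - ∑ i, algebraMap k E (a i) * w i),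
    ⟨mul_mem (inv_mem (F.algebraMap_mem _)) hdF, ?_⟩, ?_⟩
  · have h1 : ((1 : ℝ) : EReal) ≤ νE (x - ∑ i, algebraMap k E (a i) * w i) := by
      by_cases h0 : x - ∑ i, algebraMap k E (a i) * w i = 0
      · simp [h0, hE.map_zero]
      · obtain ⟨m, hm⟩ := hF ⟨_, hdF⟩ h0
        rw [hm] at hpos ⊢
        rw [EReal.coe_pos] at hpos
        rw [EReal.coe_le_coe_iff]
        have : 0 < m := by exact_mod_cast hpos
        exact_mod_cast this
    simpa using hE.le_mul (hE.map_inv hπE).ge h1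
  · rw [mul_inv_cancel_left₀ hπ0]
    ring

lemma mem_of_forall_exists_le (hk : IsLocalValuation k νk 1 q) (hE : IsLocalValuation E νE e qE)
    (hcompat : ∀ c : k, νE (algebraMap k E c) = νk c) (F : IntermediateField k E)
    {ι : Type*} [Fintype ι] {w : ι → E} (hwF : ∀ i, w i ∈ F) (hw : ∀ i, 0 ≤ νE (w i))
    (hspan : ∀ x ∈ F, 0 ≤ νE x → ∃ a : ι → k, (∀ i, 0 ≤ νk (a i)) ∧
      x = ∑ i, algebraMap k E (a i) * w i)
    {x : E} (hx : 0 ≤ νE x) (hlim : ∀ N : ℕ, ∃ y ∈ F, ((N : ℝ) : EReal) ≤ νE (x - y)) :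
    x ∈ F := by
  obtain ⟨π, hπ⟩ := hk.exists_map_eq_one
  have hπE : νE (algebraMap k E π) = ((1 : ℝ) : EReal) := by rw [hcompat, hπ]
  have hπ0 : algebraMap k E π ≠ 0 := by
    intro h0
    rw [h0, hE.map_zero] at hπE
    exact EReal.coe_ne_top _ hπE.symm
  obtain ⟨a, -, rfl⟩ := hk.exists_sum_eq_of_approx hE hcompat hw hπ
    (S := {x | 0 ≤ νE x ∧ ∀ N : ℕ, ∃ y ∈ F, ((N : ℝ) : EReal) ≤ νE (x - y)})
    (fun x hx => hx.1) (by
      rintro x ⟨hx, hlim⟩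
      obtain ⟨y, hyF, hy⟩ := hlim 1
      rw [Nat.cast_one] at hy
      have hy0 : 0 ≤ νE y := hE.nonneg_sub hx (by
        rw [hE.sub_comm]
        exact le_trans (by norm_num) hy)
      obtain ⟨a, ha, hay⟩ := hspan y hyF hy0
      refine ⟨a, ha, (algebraMap k E π)⁻¹ * (x - y), ⟨?_, fun N => ?_⟩, ?_⟩
      · simpa using hE.le_mul (hE.map_inv hπE).ge hy
      · obtain ⟨z, hzF, hz⟩ := hlim (N + 1)
        refine ⟨(algebraMap k E π)⁻¹ * (z - y),
          mul_mem (inv_mem (F.algebraMap_mem _)) (sub_mem hzF hyF), ?_⟩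
        rw [← mul_sub, sub_sub_sub_cancel_right]
        refine le_trans ?_ (hE.le_mul (hE.map_inv hπE).ge hz)
        rw [EReal.coe_le_coe_iff]
        push_cast
        linarith
      · rw [mul_inv_cancel_left₀ hπ0, ← hay]
        ring) ⟨hx, hlim⟩
  exact sum_mem fun i _ => mul_mem (F.algebraMap_mem _) (hwF i)

/-- The inclusion of valuation rings of an extension of local fields. -/
def integersMap (hk : IsLocalValuation k νk 1 q) (hE : IsLocalValuation E νE e qE)
    (hcompat : ∀ c : k, νE (algebraMap k E c) = νk c) : hk.integers →+* hE.integers :=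
  ((algebraMap k E).comp hk.integers.subtype).codRestrict hE.integers fun x => by
    have : 0 ≤ νk x := x.2
    change 0 ≤ νE (algebraMap k E x)
    rwa [hcompat]

@[simp] lemma coe_integersMap (hk : IsLocalValuation k νk 1 q) (hE : IsLocalValuation E νE e qE)
    (hcompat : ∀ c : k, νE (algebraMap k E c) = νk c) (x : hk.integers) :
    (integersMap hk hE hcompat x : E) = algebraMap k E x := rfl

lemma exists_residueMap (hk : IsLocalValuation k νk 1 q) (hE : IsLocalValuation E νE e qE)
    (hcompat : ∀ c : k, νE (algebraMap k E c) = νk c) :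
    ∃ φ : IsLocalRing.ResidueField hk.integers →+* IsLocalRing.ResidueField hE.integers,
      ∀ x, φ (IsLocalRing.residue _ x) = IsLocalRing.residue _ (integersMap hk hE hcompat x) :=
  ⟨Ideal.Quotient.lift _ ((IsLocalRing.residue hE.integers).comp (integersMap hk hE hcompat))
    fun x hx => by
      have h1 := (hk.residue_eq_zero_iff x).1 (Ideal.Quotient.eq_zero_iff_mem.2 hx)
      rw [RingHom.comp_apply, hE.residue_eq_zero_iff, coe_integersMap, hcompat]
      exact h1, fun _ => rfl⟩

/-- An unramified intermediate field has degree at most the residue degree; in case of equality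
all residue classes have representatives in it. -/
lemma exists_integral_basis [FiniteDimensional k E] (hk : IsLocalValuation k νk 1 q)
    (hE : IsLocalValuation E νE e qE)
    (hcompat : ∀ c : k, νE (algebraMap k E c) = νk c) {f : ℕ} (hresdeg : qE = q ^ f)
    (F : IntermediateField k E)
    (hF : ∀ x : F, (x : E) ≠ 0 → ∃ m : ℤ, νE (x : E) = ((m : ℝ) : EReal)) :
    Module.finrank k F ≤ f ∧ ∃ (r : ℕ) (w : Fin r → E), (∀ i, w i ∈ F) ∧ (∀ i, 0 ≤ νE (w i)) ∧
      (∀ x ∈ F, 0 ≤ νE x → ∃ a : Fin r → k, (∀ i, 0 ≤ νk (a i)) ∧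
        x = ∑ i, algebraMap k E (a i) * w i) ∧
      (Module.finrank k F = f → ∀ x, 0 ≤ νE x → ∃ y ∈ F, 0 ≤ νE y ∧ 0 < νE (x - y)) := by
  obtain ⟨φ, hφ⟩ := exists_residueMap hk hE hcompat
  let := φ.toAlgebra
  have := hk.finite_residueField
  have := hE.finite_residueField
  have hfin : Module.finrank (IsLocalRing.ResidueField hk.integers)
      (IsLocalRing.ResidueField hE.integers) = f := by
    have h1 := Module.natCard_eq_pow_finrank (K := IsLocalRing.ResidueField hk.integers)
      (V := IsLocalRing.ResidueField hE.integers)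
    rw [hk.natCard_residueField, hE.natCard_residueField] at h1
    exact (Nat.pow_right_injective hk.one_lt_q (hresdeg.symm.trans h1)).symm
  let W : Submodule (IsLocalRing.ResidueField hk.integers)
      (IsLocalRing.ResidueField hE.integers) :=
    { carrier := {c | ∃ y : hE.integers, (y : E) ∈ F ∧ IsLocalRing.residue _ y = c}
      add_mem' := by
        rintro _ _ ⟨y, hy, rfl⟩ ⟨z, hz, rfl⟩
        exact ⟨y + z, add_mem hy hz, _root_.map_add _ _ _⟩
      zero_mem' := ⟨0, zero_mem F, _root_.map_zero _⟩
      smul_mem' := by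
        rintro c _ ⟨y, hy, rfl⟩
        obtain ⟨c, rfl⟩ := IsLocalRing.residue_surjective c
        refine ⟨integersMap hk hE hcompat c * y, mul_mem (F.algebraMap_mem _) hy, ?_⟩
        rw [Algebra.smul_def, RingHom.algebraMap_toAlgebra, hφ, _root_.map_mul] }
  let B := Module.finBasis (IsLocalRing.ResidueField hk.integers) W
  have hlift : ∀ i, ∃ y : hE.integers, (y : E) ∈ F ∧
      IsLocalRing.residue _ y = (B i : IsLocalRing.ResidueField hE.integers) := fun i => (B i).2
  choose w hwF hwB using hlift
  have hw0 : ∀ i, 0 ≤ νE (w i) := fun i => (w i).2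
  have hspan : ∀ x ∈ F, 0 ≤ νE x → ∃ a : _ → k, (∀ i, 0 ≤ νk (a i)) ∧
        x = ∑ i, algebraMap k E (a i) * (w i : E) := by
    intro x hxF hx
    refine hk.exists_sum_eq_of_residue hE hcompat F hF hwF hw0 ?_ hxF hx
    intro x hxF hx
    let c : W := ⟨IsLocalRing.residue _ ⟨x, hx⟩, ⟨x, hx⟩, hxF, rfl⟩
    have hsurj := fun i => IsLocalRing.residue_surjective (B.repr c i)
    choose a ha using hsurj
    refine ⟨fun i => a i, fun i => (a i).2, ?_⟩
    have hc : IsLocalRing.residue hE.integers ⟨x, hx⟩ =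
        IsLocalRing.residue _ (∑ i, integersMap hk hE hcompat (a i) * w i) := by
      have h1 := congrArg Subtype.val (B.sum_repr c)
      simp only [Submodule.coe_sum, Submodule.coe_smul, c] at h1
      rw [← h1, _root_.map_sum]
      refine Finset.sum_congr rfl fun i _ => ?_
      rw [Algebra.smul_def, RingHom.algebraMap_toAlgebra, ← ha, hφ, _root_.map_mul, hwB]
    rw [hE.residue_eq_iff] at hc
    simpa using hc
  have hle : Module.finrank k F ≤ Module.finrank (IsLocalRing.ResidueField hk.integers) W := by
    have hsub : (F.toSubmodule) ≤ Submodule.span k (Set.range fun i => (w i : E)) := by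
      intro x hx
      obtain ⟨π, hπ⟩ := hk.exists_map_eq_one
      have hπE : νE (algebraMap k E π) = ((1 : ℝ) : EReal) := by rw [hcompat, hπ]
      have hπ0 : π ≠ 0 := by
        rintro rfl
        rw [hk.map_zero] at hπ
        exact EReal.coe_ne_top _ hπ.symm
      obtain ⟨n, hn⟩ : ∃ n : ℕ, 0 ≤ νE (algebraMap k E π ^ n * x) := by
        by_cases hx0 : x = 0
        · exact ⟨0, by simp [hx0, hE.map_zero]⟩
        obtain ⟨r, hr⟩ := hE.exists_real hx0
        obtain ⟨n, hn⟩ := exists_nat_gt (-r)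
        refine ⟨n, ?_⟩
        rw [hE.map_mul, hE.map_pow hπE, hr, ← EReal.coe_add, EReal.coe_nonneg]
        linarith
      obtain ⟨a, -, ha⟩ := hspan _ (mul_mem (pow_mem (F.algebraMap_mem _) _) hx) hn
      have hx' : x = (π ^ n)⁻¹ • ∑ i, a i • (w i : E) := by
        simp only [Algebra.smul_def, ← ha]
        rw [_root_.map_inv₀, _root_.map_pow, inv_mul_cancel_left₀]
        simpa using fun h => absurd h hπ0
      rw [hx']
      exact Submodule.smul_mem _ _ (Submodule.sum_mem _ fun i _ =>
        Submodule.smul_mem _ _ (Submodule.subset_span ⟨i, rfl⟩))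
    have h1 := (Submodule.finrank_mono hsub).trans (finrank_range_le_card _)
    simpa using h1
  refine ⟨hle.trans ((Submodule.finrank_le W).trans hfin.le), _, fun i => w i, hwF, hw0, hspan, ?_⟩
  intro hFf x hx
  have htop : W = ⊤ := Submodule.eq_top_of_finrank_eq
    (le_antisymm (Submodule.finrank_le W) (by rw [hfin, ← hFf]; exact hle))
  obtain ⟨y, hyF, hy⟩ : IsLocalRing.residue _ (⟨x, hx⟩ : hE.integers) ∈ W := htop ▸ trivial
  exact ⟨y, hyF, y.2, (hE.residue_eq_iff _ _).1 hy.symm⟩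

/-- An unramified intermediate field of maximal degree contains all Teichmüller
representatives. -/
lemma mem_of_pow_card_eq [FiniteDimensional k E] (hk : IsLocalValuation k νk 1 q)
    (hE : IsLocalValuation E νE e qE)
    (hcompat : ∀ c : k, νE (algebraMap k E c) = νk c) {f : ℕ} (hresdeg : qE = q ^ f)
    (F : IntermediateField k E)
    (hF : ∀ x : F, (x : E) ≠ 0 → ∃ m : ℤ, νE (x : E) = ((m : ℝ) : EReal))
    (hFf : Module.finrank k F = f) {ζ : E} (hζ : ζ ^ qE = ζ) : ζ ∈ F := by
  obtain ⟨-, r, w, hwF, hw, hspan, hsurj⟩ := exists_integral_basis hk hE hcompat hresdeg F hF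
  have hζ0 := hE.nonneg_of_pow_card_eq hζ
  obtain ⟨y, hyF, hy, hζy⟩ := hsurj hFf ζ hζ0
  obtain ⟨ξ, hξ, hyξ, hlim⟩ := hE.exists_teichmuller hy
  have : ζ = ξ := hE.eq_of_pow_card_eq hζ hξ (by
    rw [← sub_add_sub_cancel _ y]
    exact hE.lt_add hζy hyξ)
  subst this
  refine mem_of_forall_exists_le hk hE hcompat F hwF hw hspan hζ0 fun N => ?_
  obtain ⟨n, hn⟩ := hlim N
  exact ⟨y ^ n, pow_mem hyF n, hn⟩

/-- There is a Teichmüller representative whose powers represent all nonzero residue classes. -/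
lemma exists_generator (hE : IsLocalValuation E νE e qE) :
    ∃ ζ : E, ζ ^ qE = ζ ∧
      ∀ x, 0 ≤ νE x → 0 < νE x ∨ ∃ i : Fin qE, 0 < νE (x - ζ ^ (i : ℕ)) := by
  have := hE.finite_residueField
  obtain ⟨g, hg⟩ := IsCyclic.exists_generator (α := (IsLocalRing.ResidueField hE.integers)ˣ)
  obtain ⟨y, hy⟩ := IsLocalRing.residue_surjective (g : IsLocalRing.ResidueField hE.integers)
  obtain ⟨ζ, hζ, hyζ, -⟩ := hE.exists_teichmuller y.2
  have hζ0 := hE.nonneg_of_pow_card_eq hζ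
  have hres : IsLocalRing.residue hE.integers ⟨ζ, hζ0⟩ = g := by
    rw [← hy]
    exact ((hE.residue_eq_iff _ _).2 hyζ).symm
  refine ⟨ζ, hζ, fun x hx => ?_⟩
  by_cases hx0 : IsLocalRing.residue hE.integers ⟨x, hx⟩ = 0
  · exact Or.inl ((hE.residue_eq_zero_iff _).1 hx0)
  right
  have hmem : Units.mk0 _ hx0 ∈ Submonoid.powers g := by
    rw [mem_powers_iff_mem_zpowers]
    exact hg _
  classical
  rw [mem_powers_iff_mem_range_orderOf] at hmem
  obtain ⟨i, hi, hgi⟩ := Finset.mem_image.1 hmem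
  have hlt : i < qE := by
    have h1 : orderOf g ≤ Nat.card (IsLocalRing.ResidueField hE.integers)ˣ :=
      orderOf_le_card
    have h2 := Nat.card_units (IsLocalRing.ResidueField hE.integers)
    rw [hE.natCard_residueField] at h2
    have h4 := Finset.mem_range.1 hi
    have h5 := hE.one_lt_q
    omega
  refine ⟨⟨i, hlt⟩, ?_⟩
  have h3 := congrArg Units.val hgi
  simp only [Units.val_pow_eq_pow_val, Units.val_mk0, ← hres] at h3
  rw [← _root_.map_pow] at h3
  exact (hE.residue_eq_iff _ _).1 h3.symm

end Unramified

end IsLocalValuation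

namespace IsLocalValuation

section Frobenius

open Polynomial IntermediateField

variable {k E : Type*} [Field k] [Field E] [Algebra k E] {νk : k → EReal} {νE : E → EReal}
  {e q qE : ℕ}

lemma exists_frobenius (hk : IsLocalValuation k νk 1 q) (hE : IsLocalValuation E νE e qE)
    (hcompat : ∀ c : k, νE (algebraMap k E c) = νk c) :
    ∃ Φ : IsLocalRing.ResidueField hE.integers →+* IsLocalRing.ResidueField hE.integers,
      (∀ c, Φ c = c ^ q) ∧ ∀ x, Φ (IsLocalRing.residue _ (integersMap hk hE hcompat x)) =
        IsLocalRing.residue _ (integersMap hk hE hcompat x) := by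
  obtain ⟨φ, hφ⟩ := exists_residueMap hk hE hcompat
  let := φ.toAlgebra
  have := hk.finite_residueField
  have := Fintype.ofFinite (IsLocalRing.ResidueField hk.integers)
  refine ⟨(FiniteField.frobeniusAlgHom (IsLocalRing.ResidueField hk.integers)
    (IsLocalRing.ResidueField hE.integers)).toRingHom, fun c => ?_, fun x => ?_⟩
  · change c ^ Fintype.card _ = _
    rw [← Nat.card_eq_fintype_card, hk.natCard_residueField]
  · rw [← hφ]
    exact AlgHom.commutes (FiniteField.frobeniusAlgHom (IsLocalRing.ResidueField hk.integers)
      (IsLocalRing.ResidueField hE.integers)) _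

/-- The `q`-th power of a Teichmüller representative is one of its conjugates. -/
lemma aeval_pow_minpoly_eq_zero (hk : IsLocalValuation k νk 1 q)
    (hE : IsLocalValuation E νE e qE) (hcompat : ∀ c : k, νE (algebraMap k E c) = νk c)
    {ζ : E} (hζ : ζ ^ qE = ζ) : aeval (ζ ^ q) (minpoly k ζ) = 0 := by
  obtain ⟨Φ, hΦ, hΦk⟩ := exists_frobenius hk hE hcompat
  let z : hE.integers := ⟨ζ, hE.nonneg_of_pow_card_eq hζ⟩
  have hz : z ^ qE = z := Subtype.ext hζ
  have hq1 := hE.one_lt_q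
  have hmonic : (X ^ qE - X : hk.integers[X]).Monic :=
    monic_X_pow_sub (by rw [degree_X]; exact_mod_cast hq1)
  have hroot : aeval ζ (X ^ qE - X : hk.integers[X]) = 0 := by simp [hζ]
  have hint : IsIntegral hk.integers ζ := ⟨_, hmonic, hroot⟩
  obtain ⟨R, hR⟩ := minpoly.isIntegrallyClosed_dvd hint hroot
  set P := minpoly hk.integers ζ with hP
  let ι := integersMap hk hE hcompat
  let res := IsLocalRing.residue hE.integers
  have hcoe : ∀ (p : hk.integers[X]) (y : hE.integers),
      ((eval₂ ι y p : hE.integers) : E) = aeval (y : E) p := by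
    intro p y
    have h1 := hom_eval₂ p ι hE.integers.subtype y
    exact h1
  rw [minpoly.isIntegrallyClosed_eq_field_fractions' k hint, aeval_map_algebraMap, ← hP]
  have hcoe' := hcoe P (z ^ q)
  rw [show ((z ^ q : hE.integers) : E) = ζ ^ q from rfl] at hcoe'
  rw [← hcoe']
  suffices h : eval₂ ι (z ^ q) P = 0 by rw [h]; rfl
  by_contra hne
  have hPz : eval₂ ι z P = 0 := by
    refine Subtype.ext ((hcoe P z).trans ?_)
    exact minpoly.aeval _ _
  have hprod : eval₂ ι (z ^ q) P * eval₂ ι (z ^ q) R = 0 := by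
    rw [← eval₂_mul, ← hR]
    simp only [eval₂_sub, eval₂_pow, eval₂_X]
    rw [← pow_mul, mul_comm, pow_mul, hz, sub_self]
  have hRz : eval₂ ι (z ^ q) R = 0 := (mul_eq_zero.1 hprod).resolve_left hne
  have hRbar : eval (res z ^ q) (R.map (res.comp ι)) = 0 := by
    rw [eval_map, ← _root_.map_pow, ← hom_eval₂, hRz, _root_.map_zero]
  have hPbar : eval (res z ^ q) (P.map (res.comp ι)) = 0 := by
    have h2 : Φ.comp (res.comp ι) = res.comp ι := RingHom.ext hΦk
    rw [eval_map, ← hΦ, ← h2, ← hom_eval₂, ← hom_eval₂, hPz, _root_.map_zero, _root_.map_zero]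
  have hder := congrArg (fun p => eval (res z ^ q) (derivative (p.map (res.comp ι)))) hR
  have hfin := hE.finite_residueField
  have := Fintype.ofFinite (IsLocalRing.ResidueField hE.integers)
  have hchar := FiniteField.cast_card_eq_zero (IsLocalRing.ResidueField hE.integers)
  rw [← Nat.card_eq_fintype_card, hE.natCard_residueField] at hchar
  simp [derivative_X_pow, hRbar, hPbar, hchar] at hder

lemma exists_sum_powers [FiniteDimensional k E] (hk : IsLocalValuation k νk 1 q)
    (hE : IsLocalValuation E νE e qE) (hcompat : ∀ c : k, νE (algebraMap k E c) = νk c)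
    (F : IntermediateField k E)
    (hF : ∀ x : F, (x : E) ≠ 0 → ∃ m : ℤ, νE (x : E) = ((m : ℝ) : EReal))
    {ζ : E} (hζ : ζ ^ qE = ζ)
    (hgen : ∀ x, 0 ≤ νE x → 0 < νE x ∨ ∃ i : Fin qE, 0 < νE (x - ζ ^ (i : ℕ)))
    (hζF : ζ ∈ F) {x : E} (hxF : x ∈ F) (hx : 0 ≤ νE x) :
    ∃ a : Fin qE → k, (∀ i, 0 ≤ νk (a i)) ∧ x = ∑ i, algebraMap k E (a i) * ζ ^ (i : ℕ) := by
  refine hk.exists_sum_eq_of_residue hE hcompat F hF (w := fun i : Fin qE => ζ ^ (i : ℕ))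
    (fun i => pow_mem hζF _)
    (fun i => hE.mem_integers.1 (pow_mem (hE.mem_integers.2 (hE.nonneg_of_pow_card_eq hζ)) _))
    (fun x hxF hx => ?_) hxF hx
  rcases hgen x hx with h | ⟨i, hi⟩
  · exact ⟨0, by simp [hk.map_zero], by simpa using h⟩
  · refine ⟨Pi.single i 1, fun j => ?_, ?_⟩
    · by_cases hj : j = i
      · subst hj; simp [hk.map_one]
      · simp [hj, hk.map_zero]
    · have h1 : ∑ j, algebraMap k E ((Pi.single i 1 : Fin qE → k) j) * ζ ^ (j : ℕ)
          = ζ ^ (i : ℕ) := by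
        rw [Finset.sum_eq_single i]
        · simp
        · intro j _ hj
          simp [hj]
        · simp
      rwa [h1]

lemma adjoin_eq [FiniteDimensional k E] (hk : IsLocalValuation k νk 1 q)
    (hE : IsLocalValuation E νE e qE) (hcompat : ∀ c : k, νE (algebraMap k E c) = νk c)
    (F : IntermediateField k E)
    (hF : ∀ x : F, (x : E) ≠ 0 → ∃ m : ℤ, νE (x : E) = ((m : ℝ) : EReal))
    {ζ : E} (hζ : ζ ^ qE = ζ)
    (hgen : ∀ x, 0 ≤ νE x → 0 < νE x ∨ ∃ i : Fin qE, 0 < νE (x - ζ ^ (i : ℕ)))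
    (hζF : ζ ∈ F) : k⟮ζ⟯ = F := by
  refine le_antisymm (adjoin_simple_le_iff.2 hζF) fun x hx => ?_
  have key : ∀ y ∈ F, 0 ≤ νE y → y ∈ k⟮ζ⟯ := by
    intro y hyF hy
    obtain ⟨a, -, rfl⟩ := exists_sum_powers hk hE hcompat F hF hζ hgen hζF hyF hy
    exact sum_mem fun i _ => mul_mem (k⟮ζ⟯.algebraMap_mem _)
      (pow_mem (mem_adjoin_simple_self k ζ) _)
  rcases hE.integers.mem_or_inv_mem x with h | h
  · exact key x hx h
  · simpa using inv_mem (key x⁻¹ (inv_mem hx) h)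

/-- An automorphism raising a generating Teichmüller representative to its `q`-th power induces
the Frobenius automorphism on the unramified subextension. -/
lemma map_mem_and_sub_pow_pos [FiniteDimensional k E] (hk : IsLocalValuation k νk 1 q)
    (hE : IsLocalValuation E νE e qE) (hcompat : ∀ c : k, νE (algebraMap k E c) = νk c)
    (F : IntermediateField k E)
    (hF : ∀ x : F, (x : E) ≠ 0 → ∃ m : ℤ, νE (x : E) = ((m : ℝ) : EReal))
    {ζ : E} (hζ : ζ ^ qE = ζ)
    (hgen : ∀ x, 0 ≤ νE x → 0 < νE x ∨ ∃ i : Fin qE, 0 < νE (x - ζ ^ (i : ℕ)))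
    (hζF : ζ ∈ F) (σ : E ≃ₐ[k] E) (hσ : σ ζ = ζ ^ q) :
    (∀ x ∈ F, σ x ∈ F) ∧ ∀ x ∈ F, 0 ≤ νE x → 0 < νE (σ x - x ^ q) := by
  constructor
  · have h1 : k⟮ζ⟯ ≤ F.comap σ.toAlgHom := by
      rw [adjoin_simple_le_iff]
      change σ ζ ∈ F
      rw [hσ]
      exact pow_mem hζF q
    rw [adjoin_eq hk hE hcompat F hF hζ hgen hζF] at h1
    exact fun x hx => h1 hx
  · intro x hxF hx
    obtain ⟨a, ha, hxa⟩ := exists_sum_powers hk hE hcompat F hF hζ hgen hζF hxF hx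
    obtain ⟨Φ, hΦ, hΦk⟩ := exists_frobenius hk hE hcompat
    let z : hE.integers := ⟨ζ, hE.nonneg_of_pow_card_eq hζ⟩
    let b : Fin qE → hE.integers := fun i => integersMap hk hE hcompat ⟨a i, ha i⟩
    have h1 : (⟨x, hx⟩ : hE.integers) = ∑ i, b i * z ^ (i : ℕ) := by
      refine Subtype.ext ?_
      simpa [b, z] using hxa
    have h2 : σ x = ((∑ i, b i * (z ^ q) ^ (i : ℕ) : hE.integers) : E) := by
      rw [hxa]
      simp [b, z, hσ]
    have h3 : IsLocalRing.residue hE.integers (∑ i, b i * (z ^ q) ^ (i : ℕ)) =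
        IsLocalRing.residue hE.integers (⟨x, hx⟩ ^ q) := by
      rw [_root_.map_pow, ← hΦ, h1]
      simp only [_root_.map_sum, _root_.map_mul, _root_.map_pow, hΦ (IsLocalRing.residue _ z), b,
        hΦk]
    rw [hE.residue_eq_iff] at h3
    rw [h2]
    exact h3

/-- An automorphism of `E = T(ζ)` fixing `T` with `ζ ↦ ξ` exists if `ξ` is a conjugate of `ζ`
over `k` and `ζ` has the same degree over `T` as over `k`. -/
lemma exists_algEquiv_of_sup_eq_top {k E : Type*} [Field k] [Field E] [Algebra k E]
    [FiniteDimensional k E] (T : IntermediateField k E) {ζ ξ : E}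
    (hξ : aeval ξ (minpoly k ζ) = 0)
    (hdeg : Module.finrank k T * Module.finrank k k⟮ζ⟯ = Module.finrank k E)
    (htop : T ⊔ k⟮ζ⟯ = ⊤) : ∃ σ : E ≃ₐ[k] E, σ ζ = ξ := by
  have hk : IsIntegral k ζ := .of_finite k ζ
  have hT : IsIntegral T ζ := .of_finite T ζ
  have hTtop : T⟮ζ⟯ = ⊤ := by
    have h1 : T ⊔ k⟮ζ⟯ ≤ T⟮ζ⟯.restrictScalars k := by
      refine sup_le (fun x hx => ?_) ?_
      · exact T⟮ζ⟯.algebraMap_mem ⟨x, hx⟩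
      · rw [adjoin_simple_le_iff]
        exact mem_adjoin_simple_self T ζ
    rw [htop] at h1
    exact _root_.eq_top_iff.2 fun x _ => h1 (mem_top (x := x))
  have hmin : (minpoly k ζ).map (algebraMap k T) = minpoly T ζ := by
    refine eq_of_monic_of_dvd_of_natDegree_le (minpoly.monic hT) ((minpoly.monic hk).map _)
      (minpoly.dvd_map_of_isScalarTower k T ζ) ?_
    rw [natDegree_map, ← adjoin.finrank hk, ← adjoin.finrank hT, hTtop, finrank_top']
    rw [← Module.finrank_mul_finrank k T E] at hdeg
    exact (Nat.eq_of_mul_eq_mul_left Module.finrank_pos hdeg).le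
  have hξT : aeval ξ (minpoly T (adjoin.powerBasis hT).gen) = 0 := by
    rw [adjoin.powerBasis_gen, minpoly_gen, ← hmin, aeval_map_algebraMap, hξ]
  let τ : E →ₐ[T] E := ((adjoin.powerBasis hT).lift ξ hξT).comp
    (topEquiv.symm.trans (equivOfEq hTtop.symm)).toAlgHom
  have hτ : τ ζ = ξ := by
    have h2 := (adjoin.powerBasis hT).lift_gen ξ hξT
    rw [adjoin.powerBasis_gen] at h2
    exact h2
  exact ⟨(AlgEquiv.ofBijective τ τ.bijective).restrictScalars k, hτ⟩

end Frobenius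

end IsLocalValuation

/-- Let `E|k` be a finite extension of non-Archimedean local fields
(`νk`, `νE` the valuations, `e = e(E|k)`, `f = f(E|k)`, `q = #κ_k`, `qE = #κ_E = q^f`),
and let `Eur` be the maximal unramified subextension (the intermediate field that is
unramified over `k`, i.e. has `ℤ`-valued valuation, of degree `f`).  If `E|k` is normal,
or `E` is `k`-algebra isomorphic to `T ⊗_k L` with `T|k` totally ramified and `L|k`
unramified (equivalently, there are intermediate fields `T`, `L` of `E|k`, `T` totally
ramified and `L` unramified over `k`, with `[T:k]·[L:k] = [E:k]` and compositum `E`),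
then the Frobenius automorphism of `E_ur|k` extends to a `k`-algebra automorphism of
`E`: there is `ψ ∈ Aut(E|k)` preserving `Eur` and inducing `x ↦ x^q` on the residue
field of `Eur`. -/
theorem stmt_3
    {k E : Type*} [Field k] [Field E] [Algebra k E] [FiniteDimensional k E]
    (νk : k → EReal) (νE : E → EReal) (e f q qE : ℕ)
    (hk : IsLocalValuation k νk 1 q) (hE : IsLocalValuation E νE e qE)
    (hcompat : ∀ c : k, νE (algebraMap k E c) = νk c)
    (hdeg : Module.finrank k E = e * f) (hresdeg : qE = q ^ f)
    (Eur : IntermediateField k E)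
    (hEur_unr : ∀ x : Eur, (x : E) ≠ 0 → ∃ m : ℤ, νE (x : E) = ((m : ℝ) : EReal))
    (hEur_deg : Module.finrank k Eur = f)
    (hyp : Normal k E ∨
      ∃ T L : IntermediateField k E,
        (∃ π : T, νE (π : E) = (((Module.finrank k T : ℝ)⁻¹ : ℝ) : EReal)) ∧
        (∀ x : L, (x : E) ≠ 0 → ∃ m : ℤ, νE (x : E) = ((m : ℝ) : EReal)) ∧
        Module.finrank k T * Module.finrank k L = Module.finrank k E ∧
        T ⊔ L = ⊤) :
    ∃ ψ : E ≃ₐ[k] E, (∀ x ∈ Eur, ψ x ∈ Eur) ∧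
      ∀ x ∈ Eur, 0 ≤ νE x → 0 < νE (ψ x - x ^ q) := by
  obtain ⟨ζ, hζ, hgen⟩ := hE.exists_generator
  have hζEur : ζ ∈ Eur :=
    hk.mem_of_pow_card_eq hE hcompat hresdeg Eur hEur_unr hEur_deg hζ
  have hroot := hk.aeval_pow_minpoly_eq_zero hE hcompat hζ
  suffices h : ∃ σ : E ≃ₐ[k] E, σ ζ = ζ ^ q by
    obtain ⟨σ, hσ⟩ := h
    exact ⟨σ, hk.map_mem_and_sub_pow_pos hE hcompat Eur hEur_unr hζ hgen hζEur σ hσ⟩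
  rcases hyp with hnormal | ⟨T, L, ⟨π, hπ⟩, hL, hdegTL, hsup⟩
  · exact minpoly.exists_algEquiv_of_root' (Algebra.IsAlgebraic.isAlgebraic ζ) hroot
  · have hLf : Module.finrank k L = f := by
      have hle := (hk.exists_integral_basis hE hcompat hresdeg L hL).1
      have hTe : Module.finrank k T ≤ e := by
        have he : (0 : ℝ) < e := by exact_mod_cast hE.e_pos
        have ht : (0 : ℝ) < Module.finrank k T := by exact_mod_cast Module.finrank_pos
        have h1 := hE.inv_le_of_pos (x := (π : E)) (by
          rw [hπ, EReal.coe_pos]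
          positivity)
        rw [hπ, EReal.coe_le_coe_iff, inv_le_inv₀ he ht] at h1
        exact_mod_cast h1
      refine le_antisymm hle (Nat.le_of_mul_le_mul_left ?_ hE.e_pos)
      rw [← hdeg, ← hdegTL]
      exact Nat.mul_le_mul_right _ hTe
    have hζL : ζ ∈ L := hk.mem_of_pow_card_eq hE hcompat hresdeg L hL hLf hζ
    have hadj := hk.adjoin_eq hE hcompat L hL hζ hgen hζL
    exact IsLocalValuation.exists_algEquiv_of_sup_eq_top T hroot (by rw [hadj, hdegTL])
      (by rw [hadj, hsup])
end
end

section
/- Let E|k be a finite extension of non-Archimedean local fields and set e := e(E|k), f := f(E|k). Assume f is coprime to e. Then the following assertions are equivalent: (1) the Frobenius automorphism of E_ur|k extends to an element of Aut(E|k) (the strong extension property); (2) f divides the order of Aut(E|k); (3) Aut(E|k) is isomorphic to a semidirect product Aut(E|E_ur) ⋊ ℤ/fℤ; (4) Aut(E|k) has a subgroup of order f; (5) there is an intermediate field E′ of E|k with [E′:k] = e; (6) E is k-algebra isomorphic to a tensor product T ⊗_k L of a totally ramified extension T|k and an unramified extension L|k. -/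
noncomputable section

section UltrametricField

open IsLocalRing Polynomial

/-- The valuation ring of an ultrametric normed field. -/
abbrev normRing (K : Type*) [NormedField K] [IsUltrametricDist K] : ValuationSubring K :=
  (NormedField.valuation (K := K)).valuationSubring

/-- The residue field of an ultrametric normed field. -/
abbrev normResidue (K : Type*) [NormedField K] [IsUltrametricDist K] : Type _ :=
  ResidueField (normRing K)

section NormedField

variable {K : Type*} [NormedField K] [IsUltrametricDist K]

theorem mem_normRing {x : K} : x ∈ normRing K ↔ ‖x‖ ≤ 1 := by
  rw [Valuation.mem_valuationSubring_iff, NormedField.valuation_apply, ← NNReal.coe_le_coe]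
  simp

theorem residue_eq_zero_iff_norm (x : normRing K) :
    residue (normRing K) x = 0 ↔ ‖(x : K)‖ < 1 := by
  have hu : IsUnit x ↔ NormedField.valuation (x : K) = 1 :=
    (Valuation.integer.integers (NormedField.valuation (K := K))).isUnit_iff_valuation_eq_one
  have hx : ‖(x : K)‖ ≤ 1 := mem_normRing.mp x.2
  rw [residue_eq_zero_iff, mem_maximalIdeal, mem_nonunits_iff, hu, NormedField.valuation_apply,
    ← NNReal.coe_inj, lt_iff_le_and_ne]
  simp [hx]

theorem residue_eq_iff_norm (x y : normRing K) :
    residue (normRing K) x = residue (normRing K) y ↔ ‖(x : K) - y‖ < 1 := by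
  rw [← sub_eq_zero, ← map_sub, residue_eq_zero_iff_norm]
  simp

theorem norm_sub_lt_one_trans {x y z : K} (h : ‖x - y‖ < 1) (h' : ‖y - z‖ < 1) : ‖x - z‖ < 1 := by
  rw [← sub_add_sub_cancel x y z]
  exact (IsUltrametricDist.norm_add_le_max _ _).trans_lt (max_lt h h')

theorem norm_le_one_of_sub_lt_one {x y : K} (hx : ‖x‖ ≤ 1) (h : ‖x - y‖ < 1) : ‖y‖ ≤ 1 := by
  rw [← sub_sub_cancel x y, sub_eq_add_neg]
  refine (IsUltrametricDist.norm_add_le_max _ _).trans (max_le hx ?_)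
  rw [norm_neg]
  exact h.le

theorem card_normResidue {q : ℕ} (s : Finset K) (hcard : s.card = q) (hs : ∀ y ∈ s, ‖y‖ ≤ 1)
    (h : ∀ x : K, ‖x‖ ≤ 1 → ∃! y, y ∈ s ∧ ‖x - y‖ < 1) : Nat.card (normResidue K) = q := by
  rw [← hcard, ← Nat.card_eq_finsetCard s]
  symm
  refine Nat.card_eq_of_bijective
    (fun y : s => residue (normRing K) ⟨y, mem_normRing.mpr (hs y y.2)⟩) ⟨?_, ?_⟩
  · intro y z hyz
    have hyz := (residue_eq_iff_norm _ _).mp hyz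
    exact Subtype.ext ((h y (hs y y.2)).unique ⟨y.2, by simp⟩ ⟨z.2, hyz⟩)
  · intro c
    obtain ⟨x, rfl⟩ := residue_surjective c
    obtain ⟨y, ⟨hy, hxy⟩, -⟩ := h x (mem_normRing.mp x.2)
    exact ⟨⟨y, hy⟩, ((residue_eq_iff_norm _ _).mpr hxy).symm⟩

omit [IsUltrametricDist K] in
theorem norm_le_one_of_pow_eq_self {Q : ℕ} (hQ : 1 < Q) {x : K} (hx : x ^ Q = x) : ‖x‖ ≤ 1 := by
  by_contra! h
  have := congrArg norm hx
  rw [norm_pow] at this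
  exact (lt_self_pow₀ h hQ).ne' this

variable [Finite (normResidue K)] {r : ℝ} (hr : r < 1) (hdisc : ∀ x : K, ‖x‖ < 1 → ‖x‖ ≤ r)

include hdisc in
theorem norm_pow_card_sub_le {a b : K} (ha : ‖a‖ ≤ 1) (hab : ‖a - b‖ < 1) :
    ‖a ^ Nat.card (normResidue K) - b ^ Nat.card (normResidue K)‖ ≤ r * ‖a - b‖ := by
  have hb : ‖b‖ ≤ 1 := norm_le_one_of_sub_lt_one ha hab
  rw [← (Commute.all a b).geom_sum₂_mul, norm_mul]
  refine mul_le_mul_of_nonneg_right (hdisc _ ?_) (norm_nonneg _)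
  set A : normRing K := ⟨a, mem_normRing.mpr ha⟩
  set B : normRing K := ⟨b, mem_normRing.mpr hb⟩
  have hAB : residue _ A = residue _ B := (residue_eq_iff_norm A B).mpr hab
  have key : residue _ (∑ i ∈ Finset.range (Nat.card (normResidue K)),
      A ^ i * B ^ (Nat.card (normResidue K) - 1 - i)) = 0 := by
    simp only [map_sum, map_mul, map_pow, hAB]
    have := Fintype.ofFinite (normResidue K)
    rw [geom_sum₂_self, Nat.card_eq_fintype_card, FiniteField.cast_card_eq_zero, zero_mul]
  rw [residue_eq_zero_iff_norm] at key
  simpa [A, B] using key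

include hr hdisc in
theorem eq_of_pow_card_eq_self {a b : K} (ha : a ^ Nat.card (normResidue K) = a)
    (hb : b ^ Nat.card (normResidue K) = b) (hab : ‖a - b‖ < 1) : a = b := by
  have := norm_pow_card_sub_le hdisc (norm_le_one_of_pow_eq_self Finite.one_lt_card ha) hab
  rw [ha, hb] at this
  by_contra hne
  have : 0 < ‖a - b‖ := norm_pos_iff.mpr (sub_ne_zero.mpr hne)
  nlinarith

include hr hdisc in
/-- Teichmüller representatives, inside any closed subfield. -/
theorem exists_pow_card_eq_self [CompleteSpace K] {L : Subfield K} (hL : IsClosed (L : Set K))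
    {a : K} (haL : a ∈ L) (ha : ‖a‖ ≤ 1) :
    ∃ ζ ∈ L, ζ ^ Nat.card (normResidue K) = ζ ∧ ‖a - ζ‖ < 1 := by
  set Q := Nat.card (normResidue K) with hQdef
  have hr0 : 0 ≤ r := by simpa using hdisc 0 (by simp)
  have hpow : ∀ n, ‖a ^ Q ^ n‖ ≤ 1 := fun n => by
    rw [norm_pow]; exact pow_le_one₀ (norm_nonneg _) ha
  have hstep : ∀ n, ‖a ^ Q ^ n - a ^ Q ^ (n + 1)‖ ≤ r ^ (n + 1) := by
    intro n
    induction n with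
    | zero =>
      simp only [pow_zero, pow_one, zero_add]
      apply hdisc
      set A : normRing K := ⟨a, mem_normRing.mpr ha⟩
      have : residue _ A = residue _ (A ^ Q) := by
        have := Fintype.ofFinite (normResidue K)
        rw [map_pow, hQdef, Nat.card_eq_fintype_card, FiniteField.pow_card]
      rw [residue_eq_iff_norm] at this
      simpa [A] using this
    | succ n ih =>
      have h1 : ‖a ^ Q ^ n - a ^ Q ^ (n + 1)‖ < 1 := ih.trans_lt (pow_lt_one₀ hr0 hr (by simp))
      have h2 := norm_pow_card_sub_le hdisc (hpow n) h1
      rw [← hQdef, ← pow_mul, ← pow_mul, ← pow_succ, ← pow_succ] at h2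
      refine h2.trans ?_
      rw [pow_succ' r (n + 1)]
      exact mul_le_mul_of_nonneg_left ih hr0
  have hc : CauchySeq fun n => a ^ Q ^ n := by
    refine cauchySeq_of_le_geometric r r hr fun n => ?_
    rw [dist_eq_norm, ← pow_succ']
    exact hstep n
  obtain ⟨ζ, hζ⟩ := cauchySeq_tendsto_of_complete hc
  refine ⟨ζ, hL.mem_of_tendsto hζ (.of_forall fun n => pow_mem haL _), ?_, ?_⟩
  · refine tendsto_nhds_unique (hζ.pow Q) ?_
    have := hζ.comp (Filter.tendsto_add_atTop_nat 1)
    refine this.congr fun n => ?_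
    simp [pow_succ, pow_mul]
  · have hle : ∀ n, ‖a - a ^ Q ^ n‖ ≤ r := by
      intro n
      apply hdisc
      induction n with
      | zero => simp
      | succ n ih =>
        exact norm_sub_lt_one_trans ih ((hstep n).trans_lt (pow_lt_one₀ hr0 hr (by simp)))
    exact (le_of_tendsto (tendsto_const_nhds.sub hζ).norm (.of_forall hle)).trans_lt hr

end NormedField

section Extension

variable {k E : Type*} [NontriviallyNormedField k] [NormedField E] [IsUltrametricDist E]
  [NormedAlgebra k E]

instance normValuation_hasExtension [IsUltrametricDist k] :
    (NormedField.valuation (K := k)).HasExtension (NormedField.valuation (K := E)) where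
  val_isEquiv_comap x y := by
    simp [← NNReal.coe_le_coe]

section Approximation

variable [CompleteSpace k] [FiniteDimensional k E]

/-- A submodule that approximates the elements of norm at most one of an unramified intermediate
field modulo the maximal ideal contains that field. -/
theorem le_of_forall_exists_norm_sub_lt_one {ϖ : k} (hϖ0 : ϖ ≠ 0) (hϖ : ‖ϖ‖ < 1)
    {L : IntermediateField k E} (hL : ∀ x ∈ L, x ≠ 0 → ∃ m : ℤ, ‖x‖ = ‖ϖ‖ ^ m)
    {V : Submodule k E} (hV : ∀ x ∈ L, ‖x‖ ≤ 1 → ∃ v ∈ V, v ∈ L ∧ ‖x - v‖ < 1) :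
    ∀ x ∈ L, x ∈ V := by
  have hpos : 0 < ‖ϖ‖ := norm_pos_iff.mpr hϖ0
  have key : ∀ x ∈ L, ‖x‖ ≤ 1 → x ∈ V := by
    intro x hx hx1
    have step : ∀ n : ℕ, ∃ v ∈ V, v ∈ L ∧ ‖x - v‖ ≤ ‖ϖ‖ ^ n := by
      intro n
      induction n with
      | zero => exact ⟨0, V.zero_mem, L.zero_mem, by simpa using hx1⟩
      | succ n ih =>
        obtain ⟨v, hv, hvL, hxv⟩ := ih
        have hyL : (ϖ ^ n)⁻¹ • (x - v) ∈ L := L.smul_mem (L.sub_mem hx hvL)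
        obtain ⟨w, hw, hwL, hyw⟩ := hV _ hyL (by
          rw [norm_smul, norm_inv, norm_pow, inv_mul_le_one₀ (by positivity)]
          exact hxv)
        refine ⟨v + ϖ ^ n • w, V.add_mem hv (V.smul_mem _ hw), L.add_mem hvL (L.smul_mem hwL), ?_⟩
        have hne : ϖ ^ n ≠ 0 := pow_ne_zero _ hϖ0
        have heq : x - (v + ϖ ^ n • w) = ϖ ^ n • ((ϖ ^ n)⁻¹ • (x - v) - w) := by
          rw [smul_sub, smul_inv_smul₀ hne, sub_add_eq_sub_sub]
        rw [heq, norm_smul, norm_pow, pow_succ]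
        refine mul_le_mul_of_nonneg_left ?_ (by positivity)
        rcases eq_or_ne ((ϖ ^ n)⁻¹ • (x - v) - w) 0 with h0 | h0
        · rw [h0, norm_zero]; exact hpos.le
        · obtain ⟨m, hm⟩ := hL _ (L.sub_mem hyL hwL) h0
          rw [hm] at hyw ⊢
          have : 0 < m := by
            by_contra! hm0
            exact hyw.not_ge (one_le_zpow_of_nonpos₀ hpos hϖ.le hm0)
          calc ‖ϖ‖ ^ m ≤ ‖ϖ‖ ^ (1 : ℤ) := zpow_le_zpow_right_of_le_one₀ hpos hϖ.le (by omega)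
            _ = ‖ϖ‖ := zpow_one _
    choose v hv _ hxv using step
    refine V.closed_of_finiteDimensional.mem_of_tendsto (f := v) (b := Filter.atTop) ?_
      (.of_forall hv)
    rw [tendsto_iff_norm_sub_tendsto_zero]
    refine squeeze_zero (fun _ => norm_nonneg _) (fun n => ?_)
      (tendsto_pow_atTop_nhds_zero_of_lt_one hpos.le hϖ)
    rw [norm_sub_rev]
    exact hxv n
  intro x hx
  obtain ⟨c, hc0, hc⟩ : ∃ c : k, c ≠ 0 ∧ ‖c • x‖ ≤ 1 := by
    rcases eq_or_ne x 0 with rfl | h0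
    · exact ⟨1, one_ne_zero, by simp⟩
    · obtain ⟨m, hm⟩ := hL x hx h0
      refine ⟨ϖ ^ (-m), zpow_ne_zero _ hϖ0, ?_⟩
      rw [norm_smul, norm_zpow, hm, zpow_neg, inv_mul_cancel₀ (zpow_ne_zero _ hpos.ne')]
  have := V.smul_mem c⁻¹ (key _ (L.smul_mem hx) hc)
  rwa [inv_smul_smul₀ hc0] at this

/-- The degree of an unramified intermediate field is at most the residue degree, and equality
forces the residue fields to agree. -/
theorem finrank_eq_of_unramified [IsUltrametricDist k] [Finite (normResidue E)]
    {ϖ : k} (hϖ0 : ϖ ≠ 0) (hϖ : ‖ϖ‖ < 1) {L : IntermediateField k E}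
    (hL : ∀ x ∈ L, x ≠ 0 → ∃ m : ℤ, ‖x‖ = ‖ϖ‖ ^ m)
    (hdeg : Module.finrank (normResidue k) (normResidue E) ≤ Module.finrank k L) :
    Module.finrank k L = Module.finrank (normResidue k) (normResidue E) ∧
      ∀ x : E, ‖x‖ ≤ 1 → ∃ y ∈ L, ‖x - y‖ < 1 := by
  let S : Submodule (normResidue k) (normResidue E) :=
    { carrier := {c | ∃ y : normRing E, (y : E) ∈ L ∧ residue _ y = c}
      zero_mem' := ⟨0, L.zero_mem, map_zero _⟩
      add_mem' := by
        rintro _ _ ⟨y, hy, rfl⟩ ⟨z, hz, rfl⟩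
        exact ⟨y + z, L.add_mem hy hz, map_add _ _ _⟩
      smul_mem' := by
        rintro c _ ⟨y, hy, rfl⟩
        obtain ⟨c, rfl⟩ := residue_surjective c
        refine ⟨algebraMap _ _ c * y, L.mul_mem (L.algebraMap_mem c) hy, ?_⟩
        rw [map_mul, Algebra.smul_def]
        rfl }
  have hfin : Module.Finite (normResidue k) (normResidue E) := Module.Finite.of_finite
  let b := Module.finBasis (normResidue k) S
  choose y hyL hy using fun i => (b i).2
  let V : Submodule k E := Submodule.span k (Set.range fun i => (y i : E))
  have hLV : ∀ x ∈ L, x ∈ V := by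
    refine le_of_forall_exists_norm_sub_lt_one hϖ0 hϖ hL fun x hx hx1 => ?_
    let X : normRing E := ⟨x, mem_normRing.mpr hx1⟩
    have hX : residue _ X ∈ S := ⟨X, hx, rfl⟩
    choose c hc using fun i => residue_surjective (b.repr ⟨_, hX⟩ i)
    have hsum : residue _ X =
        residue _ (∑ i, algebraMap (normRing k) (normRing E) (c i) * y i) := by
      have h1 := congrArg Subtype.val (b.sum_repr ⟨_, hX⟩)
      simp only [Submodule.coe_sum, Submodule.coe_smul] at h1
      rw [← h1, map_sum]
      refine Finset.sum_congr rfl fun i _ => ?_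
      rw [map_mul, hy, ← hc, Algebra.smul_def]
      rfl
    rw [residue_eq_iff_norm] at hsum
    refine ⟨_, ?_, ?_, hsum⟩
    · rw [AddSubmonoidClass.coe_finsetSum]
      refine V.sum_mem fun i _ => ?_
      have := V.smul_mem (c i : k) (Submodule.subset_span (Set.mem_range_self i))
      rwa [Algebra.smul_def] at this
    · rw [AddSubmonoidClass.coe_finsetSum]
      exact L.sum_mem fun i _ => L.mul_mem (L.algebraMap_mem _) (hyL i)
  have h1 : Module.finrank k L ≤ Module.finrank (normResidue k) S := by
    calc Module.finrank k L ≤ Module.finrank k V :=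
          Submodule.finrank_mono (s := L.toSubalgebra.toSubmodule) (t := V) hLV
      _ ≤ Fintype.card (Fin (Module.finrank (normResidue k) S)) := finrank_range_le_card _
      _ = _ := by simp
  have h2 : Module.finrank (normResidue k) S ≤ Module.finrank (normResidue k) (normResidue E) :=
    S.finrank_le
  refine ⟨by omega, fun x hx => ?_⟩
  have hS : S = ⊤ := Submodule.eq_top_of_finrank_eq (by omega)
  obtain ⟨z, hz, hzx⟩ : residue _ (⟨x, mem_normRing.mpr hx⟩ : normRing E) ∈ S := by
    rw [hS]; trivial
  exact ⟨z, hz, (residue_eq_iff_norm _ _).mp hzx.symm⟩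

end Approximation

section Unramified

/-- The subextension generated by the Teichmüller representatives. -/
def teichmullerField (k E : Type*) [NontriviallyNormedField k] [NormedField E]
    [IsUltrametricDist E] [NormedAlgebra k E] : IntermediateField k E :=
  IntermediateField.adjoin k {x : E | x ^ Nat.card (normResidue E) = x}

variable [CompleteSpace k] [FiniteDimensional k E] [Finite (normResidue E)]
  {r : ℝ} (hr : r < 1) (hdisc : ∀ x : E, ‖x‖ < 1 → ‖x‖ ≤ r)

include hr hdisc

theorem exists_teichmuller {L : IntermediateField k E} {a : E} (haL : a ∈ L) (ha : ‖a‖ ≤ 1) :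
    ∃ ζ ∈ L, ζ ^ Nat.card (normResidue E) = ζ ∧ ‖a - ζ‖ < 1 := by
  have : CompleteSpace E := FiniteDimensional.complete k E
  exact exists_pow_card_eq_self hr hdisc (L := L.toSubfield)
    (Submodule.closed_of_finiteDimensional L.toSubalgebra.toSubmodule) haL ha

theorem exists_teichmuller_mem {a : E} (ha : ‖a‖ ≤ 1) :
    ∃ ζ ∈ teichmullerField k E, ζ ^ Nat.card (normResidue E) = ζ ∧ ‖a - ζ‖ < 1 := by
  obtain ⟨ζ, -, h, h'⟩ := exists_teichmuller (k := k) (L := ⊤) hr hdisc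
    IntermediateField.mem_top ha
  exact ⟨ζ, IntermediateField.subset_adjoin _ _ h, h, h'⟩

theorem eq_teichmullerField_of_unramified {ϖ : k} (hϖ0 : ϖ ≠ 0) (hϖ : ‖ϖ‖ < 1)
    {L : IntermediateField k E} (hL : ∀ x ∈ L, x ≠ 0 → ∃ m : ℤ, ‖x‖ = ‖ϖ‖ ^ m)
    (hres : ∀ x : E, ‖x‖ ≤ 1 → ∃ y ∈ L, ‖x - y‖ < 1) : L = teichmullerField k E := by
  have hroot : ∀ x : E, x ^ Nat.card (normResidue E) = x → x ∈ L := by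
    intro x hx
    have hx1 := norm_le_one_of_pow_eq_self Finite.one_lt_card hx
    obtain ⟨y, hyL, hxy⟩ := hres x hx1
    obtain ⟨ζ, hζL, hζ, hyζ⟩ := exists_teichmuller hr hdisc hyL (norm_le_one_of_sub_lt_one hx1 hxy)
    rwa [eq_of_pow_card_eq_self hr hdisc hx hζ (norm_sub_lt_one_trans hxy hyζ)]
  apply le_antisymm
  · refine le_of_forall_exists_norm_sub_lt_one
      (V := (teichmullerField k E).toSubalgebra.toSubmodule)
      hϖ0 hϖ hL fun x _ hx1 => ?_
    obtain ⟨ζ, hζU, hζ, hxζ⟩ := exists_teichmuller_mem (k := k) hr hdisc hx1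
    exact ⟨ζ, hζU, hroot ζ hζ, hxζ⟩
  · exact IntermediateField.adjoin_le_iff.mpr hroot

/-- If `T` and the Teichmüller representatives generate `E`, then `E` is Galois over `T`. -/
theorem isGalois_of_sup_teichmullerField (T : IntermediateField k E)
    (hT : T ⊔ teichmullerField k E = ⊤) : IsGalois T E := by
  set Q := Nat.card (normResidue E) with hQ
  have hQ1 : 1 < Q := Finite.one_lt_card
  let p : T[X] := X ^ Q - X
  have hp : p.map (algebraMap T E) = X ^ Q - X := by simp [p]
  have hp0 : (X ^ Q - X : E[X]) ≠ 0 := FiniteField.X_pow_card_sub_X_ne_zero E hQ1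
  have hdeg : (X ^ Q - X : E[X]).natDegree = Q := FiniteField.X_pow_card_sub_X_natDegree_eq E hQ1
  have hmem : ∀ x : E, x ∈ (X ^ Q - X : E[X]).roots ↔ x ^ Q = x := by
    intro x; rw [mem_roots hp0]; simp [sub_eq_zero]
  classical
  have hcard : Q ≤ (X ^ Q - X : E[X]).roots.toFinset.card := by
    have hex : ∀ c : normResidue E, ∃ ζ : (X ^ Q - X : E[X]).roots.toFinset,
        ∃ h : ‖(ζ : E)‖ ≤ 1, residue _ (⟨ζ, mem_normRing.mpr h⟩ : normRing E) = c := by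
      intro c
      obtain ⟨x, rfl⟩ := residue_surjective c
      obtain ⟨ζ, -, hζ, hxζ⟩ := exists_teichmuller_mem (k := k) hr hdisc (mem_normRing.mp x.2)
      refine ⟨⟨ζ, by rw [Multiset.mem_toFinset, hmem]; exact hζ⟩,
        norm_le_one_of_pow_eq_self hQ1 hζ, ?_⟩
      rw [eq_comm, residue_eq_iff_norm]
      exact hxζ
    choose g hg1 hg using hex
    have hinj : Function.Injective g := by
      intro c d hcd
      rw [← hg c, ← hg d]
      simp only [hcd]
    exact (Nat.card_le_card_of_injective g hinj).trans_eq (Nat.card_eq_finsetCard _)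
  have hroots : Multiset.card (X ^ Q - X : E[X]).roots ≤ Q :=
    (card_roots' _).trans_eq hdeg
  have hle := Multiset.toFinset_card_le (X ^ Q - X : E[X]).roots
  have hsplit : (X ^ Q - X : E[X]).Splits := by
    rw [splits_iff_card_roots, hdeg]; omega
  have hsep : (X ^ Q - X : E[X]).Separable := by
    rw [← nodup_roots_iff_of_splits hp0 hsplit]
    exact Multiset.toFinset_card_eq_card_iff_nodup.mp (by omega)
  have hsf : p.IsSplittingField T E := by
    rw [isSplittingField_iff_intermediateField]
    refine ⟨by rwa [hp], ?_⟩
    rw [← IntermediateField.restrictScalars_eq_top_iff (K := k), eq_top_iff, ← hT, sup_le_iff]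
    constructor
    · intro x hx
      exact IntermediateField.algebraMap_mem (IntermediateField.adjoin T (p.rootSet E)) ⟨x, hx⟩
    · refine IntermediateField.adjoin_le_iff.mpr fun x hx => ?_
      refine IntermediateField.subset_adjoin T (p.rootSet E) ?_
      rw [mem_rootSet', hp]
      refine ⟨hp0, ?_⟩
      simpa [p, sub_eq_zero] using hx
  exact IsGalois.of_separable_splitting_field (p := p)
    ((separable_map (algebraMap T E)).mp (by rwa [hp]))

end Unramified

section ResidueAction

theorem map_mem_teichmullerField (ψ : E ≃ₐ[k] E) {x : E} (hx : x ∈ teichmullerField k E) :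
    ψ x ∈ teichmullerField k E := by
  have : teichmullerField k E ≤ (teichmullerField k E).comap (ψ : E →ₐ[k] E) := by
    refine IntermediateField.adjoin_le_iff.mpr fun ζ hζ =>
      IntermediateField.subset_adjoin k _ ?_
    change ψ ζ ^ _ = ψ ζ
    rw [← map_pow, hζ]
  exact this hx

variable [IsUltrametricDist k] [CompleteSpace k] [FiniteDimensional k E]

omit [IsUltrametricDist E] in
theorem norm_algEquiv_apply (ψ : E ≃ₐ[k] E) (x : E) : ‖ψ x‖ = ‖x‖ := by
  rw [NormedAlgebra.norm_eq_spectralNorm k, NormedAlgebra.norm_eq_spectralNorm k x]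
  exact (spectralNorm_eq_of_equiv ψ x).symm

/-- The action of `k`-automorphisms on the valuation ring. -/
def normRingAut : (E ≃ₐ[k] E) →* RingAut (normRing E) where
  toFun ψ :=
    { toFun := fun x => ⟨ψ x, mem_normRing.mpr
        ((norm_algEquiv_apply ψ x).trans_le (mem_normRing.mp x.2))⟩
      invFun := fun x => ⟨ψ.symm x, mem_normRing.mpr
        ((norm_algEquiv_apply ψ.symm x).trans_le (mem_normRing.mp x.2))⟩
      left_inv := fun _ => Subtype.ext (ψ.symm_apply_apply _)
      right_inv := fun _ => Subtype.ext (ψ.apply_symm_apply _)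
      map_mul' := fun _ _ => Subtype.ext (map_mul ψ _ _)
      map_add' := fun _ _ => Subtype.ext (map_add ψ _ _) }
  map_one' := rfl
  map_mul' _ _ := rfl

/-- The action of `k`-automorphisms on the residue field. -/
def normResidueAut : (E ≃ₐ[k] E) →* (normResidue E ≃ₐ[normResidue k] normResidue E) where
  toFun ψ := AlgEquiv.ofRingEquiv (f := ResidueField.mapAut (normRingAut ψ)) (by
    intro c
    obtain ⟨c, rfl⟩ := residue_surjective c
    rw [Valuation.HasExtension.algebraMap_residue_eq_residue_algebraMap]
    change residue _ (normRingAut ψ _) = _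
    congr 1
    exact Subtype.ext (ψ.commutes _))
  map_one' := by
    ext x
    exact DFunLike.congr_fun (map_one (ResidueField.mapAut.comp (normRingAut (k := k) (E := E)))) x
  map_mul' ψ φ := by
    ext x
    exact DFunLike.congr_fun
      (map_mul (ResidueField.mapAut.comp (normRingAut (k := k) (E := E))) ψ φ) x

theorem normResidueAut_residue (ψ : E ≃ₐ[k] E) (x : normRing E) :
    normResidueAut ψ (residue _ x) = residue _ (normRingAut ψ x) := rfl

variable [Finite (normResidue E)] {r : ℝ} (hr : r < 1) (hdisc : ∀ x : E, ‖x‖ < 1 → ‖x‖ ≤ r)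

include hr hdisc in
theorem ker_normResidueAut :
    (normResidueAut (k := k) (E := E)).ker = (teichmullerField k E).fixingSubgroup := by
  ext ψ
  rw [MonoidHom.mem_ker, IntermediateField.mem_fixingSubgroup_iff]
  constructor
  · intro h
    have hfix : teichmullerField k E ≤ IntermediateField.fixedField (Subgroup.zpowers ψ) := by
      refine IntermediateField.adjoin_le_iff.mpr fun ζ hζ => ?_
      have hζ1 := norm_le_one_of_pow_eq_self Finite.one_lt_card hζ
      have hψζ : ψ ζ = ζ := by
        refine eq_of_pow_card_eq_self hr hdisc ?_ hζ ?_
        · rw [← map_pow, hζ]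
        · have := DFunLike.congr_fun h
            (residue _ (⟨ζ, mem_normRing.mpr hζ1⟩ : normRing E))
          rw [normResidueAut_residue] at this
          exact (residue_eq_iff_norm _ _).mp this
      intro g
      exact (Subgroup.zpowers_le (H := MulAction.stabilizer (E ≃ₐ[k] E) ζ)).mpr hψζ g.2
    intro x hx
    exact hfix hx ⟨ψ, Subgroup.mem_zpowers ψ⟩
  · intro h
    ext c
    obtain ⟨x, rfl⟩ := residue_surjective c
    obtain ⟨ζ, hζU, hζ, hxζ⟩ := exists_teichmuller_mem (k := k) hr hdisc (mem_normRing.mp x.2)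
    have hζ1 := norm_le_one_of_pow_eq_self Finite.one_lt_card hζ
    have hx : residue _ x = residue _ (⟨ζ, mem_normRing.mpr hζ1⟩ : normRing E) :=
      (residue_eq_iff_norm _ _).mpr hxζ
    rw [hx, normResidueAut_residue]
    exact congrArg _ (Subtype.ext (h ζ hζU))

include hr hdisc in
/-- The Frobenius lifts to `E` exactly if the action on the residue field is surjective. -/
theorem exists_frobenius_iff_surjective [Finite (normResidue k)] :
    (∃ ψ : E ≃ₐ[k] E, (∀ x ∈ teichmullerField k E, ψ x ∈ teichmullerField k E) ∧
      ∀ x ∈ teichmullerField k E, ‖x‖ ≤ 1 → ‖ψ x - x ^ Nat.card (normResidue k)‖ < 1) ↔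
    Function.Surjective (normResidueAut (k := k) (E := E)) := by
  have := Fintype.ofFinite (normResidue k)
  rw [Nat.card_eq_fintype_card]
  constructor
  · rintro ⟨ψ, -, h⟩
    have hψ : normResidueAut ψ =
        FiniteField.frobeniusAlgEquivOfAlgebraic (normResidue k) (normResidue E) := by
      ext c
      obtain ⟨x, rfl⟩ := residue_surjective c
      obtain ⟨ζ, hζU, hζ, hxζ⟩ := exists_teichmuller_mem (k := k) hr hdisc (mem_normRing.mp x.2)
      have hζ1 := norm_le_one_of_pow_eq_self Finite.one_lt_card hζ
      have hx : residue _ x = residue _ (⟨ζ, mem_normRing.mpr hζ1⟩ : normRing E) :=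
        (residue_eq_iff_norm _ _).mpr hxζ
      rw [hx, normResidueAut_residue, FiniteField.coe_frobeniusAlgEquivOfAlgebraic]
      dsimp only
      rw [← map_pow, residue_eq_iff_norm]
      exact h ζ hζU hζ1
    intro g
    obtain ⟨n, hn⟩ := (FiniteField.bijective_frobeniusAlgEquivOfAlgebraic_pow
      (normResidue k) (normResidue E)).2 g
    exact ⟨ψ ^ n.1, by rw [map_pow, hψ]; exact hn⟩
  · intro h
    obtain ⟨ψ, hψ⟩ := h (FiniteField.frobeniusAlgEquivOfAlgebraic (normResidue k) (normResidue E))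
    refine ⟨ψ, fun x hx => map_mem_teichmullerField ψ hx, fun x _ hx1 => ?_⟩
    let X : normRing E := ⟨x, mem_normRing.mpr hx1⟩
    have := DFunLike.congr_fun hψ (residue _ X)
    rw [normResidueAut_residue, FiniteField.coe_frobeniusAlgEquivOfAlgebraic] at this
    dsimp only at this
    rw [← map_pow, residue_eq_iff_norm] at this
    exact this

end ResidueAction

section Uniformizer

variable [CompleteSpace k] [FiniteDimensional k E]

/-- The norm of an element over an intermediate field. -/
theorem exists_norm_eq_pow (T : IntermediateField k E) (x : E) :
    ∃ d : ℕ, d ∣ Module.finrank T E ∧ ∃ y ∈ T, ‖y‖ = ‖x‖ ^ d := by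
  have : CompleteSpace E := FiniteDimensional.complete k E
  have : CompleteSpace T :=
    (Submodule.closed_of_finiteDimensional T.toSubalgebra.toSubmodule).completeSpace_coe
  let : NontriviallyNormedField T := NontriviallyNormedField.ofNormNeOne (by
    obtain ⟨c, hc⟩ := NormedField.exists_one_lt_norm k
    refine ⟨algebraMap k T c, ?_, ?_⟩
    · rw [Ne, map_eq_zero]
      rintro rfl
      simp at hc
      linarith
    · change ‖algebraMap k E c‖ ≠ 1
      rw [norm_algebraMap']
      exact hc.ne')
  let : NormedAlgebra T E := { (inferInstance : Algebra T E) with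
    norm_smul_le := fun a b => (norm_mul (a : E) b).le }
  have : IsUltrametricDist T := ⟨fun a b c => IsUltrametricDist.dist_triangle_max (a : E) b c⟩
  refine ⟨(minpoly T x).natDegree, minpoly.degree_dvd (.of_finite T x),
    (minpoly T x).coeff 0, Subtype.property _, ?_⟩
  rw [NormedAlgebra.norm_eq_spectralNorm T x, spectralNorm.spectralNorm_eq_norm_coeff_zero_rpow,
    one_div, Real.rpow_inv_natCast_pow (norm_nonneg _)
      (minpoly.natDegree_pos (Algebra.IsIntegral.isIntegral x)).ne']
  rfl

end Uniformizer

end Extension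

end UltrametricField

section Group

/-- Surjectivity criterion for homomorphisms with kernel of coprime order. -/
theorem MonoidHom.surjective_iff_card_dvd {G Γ : Type*} [Group G] [Finite G] [Group Γ] [Finite Γ]
    (ρ : G →* Γ) (h : Nat.Coprime (Nat.card ρ.ker) (Nat.card Γ)) :
    Function.Surjective ρ ↔ Nat.card Γ ∣ Nat.card G := by
  have hcard : Nat.card G = Nat.card ρ.ker * Nat.card ρ.range := by
    rw [← Subgroup.card_mul_index ρ.ker, Subgroup.index_ker]
  constructor
  · intro hs
    rw [hcard, MonoidHom.range_eq_top.mpr hs, Subgroup.card_top]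
    exact dvd_mul_left _ _
  · intro hd
    rw [hcard] at hd
    have := h.symm.dvd_of_dvd_mul_left hd
    rw [← MonoidHom.range_eq_top]
    exact Subgroup.eq_top_of_le_card _ (Nat.le_of_dvd Nat.card_pos this)

/-- A surjection onto a cyclic group with kernel of coprime order splits. -/
theorem MonoidHom.exists_mulEquiv_semidirectProduct {G Γ : Type*} [Group G] [Finite G] [Group Γ]
    [IsCyclic Γ] (ρ : G →* Γ) {f : ℕ} (hf : Nat.card Γ = f) {N : Subgroup G} (hN : ρ.ker = N)
    (h : Nat.Coprime (Nat.card N) f) (hs : Function.Surjective ρ) :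
    ∃ act : Multiplicative (ZMod f) →* MulAut N,
      Nonempty (G ≃* N ⋊[act] Multiplicative (ZMod f)) := by
  subst hf hN
  have hidx : ρ.ker.index = Nat.card Γ := by
    rw [Subgroup.index_ker, MonoidHom.range_eq_top.mpr hs, Subgroup.card_top]
  obtain ⟨H, hH⟩ := Subgroup.exists_right_complement'_of_coprime (N := ρ.ker) (by rwa [hidx])
  have e₁ : Γ ≃* H :=
    ((QuotientGroup.quotientKerEquivOfSurjective ρ hs).symm).trans hH.symm.QuotientMulEquiv
  have e : Multiplicative (ZMod (Nat.card Γ)) ≃* H := (zmodCyclicMulEquiv inferInstance).trans e₁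
  exact ⟨_, ⟨(SemidirectProduct.mulEquivSubgroup hH).symm.trans
    (SemidirectProduct.congr' (MulEquiv.refl _) e.symm)⟩⟩

/-- A group isomorphic to a semidirect product has a subgroup isomorphic to the complement. -/
theorem SemidirectProduct.exists_subgroup_card_eq {G N H : Type*} [Group G] [Group N] [Group H]
    {φ : H →* MulAut N} (e : G ≃* N ⋊[φ] H) : ∃ S : Subgroup G, Nat.card S = Nat.card H :=
  ⟨((e.symm : N ⋊[φ] H →* G).comp SemidirectProduct.inr).range,
    (Nat.card_congr (MonoidHom.ofInjective
      (e.symm.injective.comp SemidirectProduct.inr_injective)).toEquiv).symm⟩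

end Group

section LocalValuation

/-- The real absolute value `x ↦ exp (-ν x)` attached to an additive valuation. -/
def valNorm {K : Type*} (ν : K → EReal) (x : K) : ℝ :=
  open Classical in if ν x = ⊤ then 0 else Real.exp (-(ν x).toReal)

theorem valNorm_nonneg {K : Type*} (ν : K → EReal) (x : K) : 0 ≤ valNorm ν x := by
  unfold valNorm
  split_ifs <;> positivity

theorem valNorm_of_eq_coe {K : Type*} {ν : K → EReal} {x : K} {a : ℝ} (h : ν x = a) :
    valNorm ν x = Real.exp (-a) := by
  simp [valNorm, h]

theorem valNorm_of_eq_top {K : Type*} {ν : K → EReal} {x : K} (h : ν x = ⊤) :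
    valNorm ν x = 0 := by
  simp [valNorm, h]

namespace IsLocalValuation

variable {K : Type*} [Field K] {ν : K → EReal} {e q : ℕ} (h : IsLocalValuation K ν e q)
include h

theorem eq_top_or_coe (x : K) : ν x = ⊤ ∨ ∃ a : ℝ, ν x = a := by
  rcases eq_or_ne x 0 with rfl | hx
  · exact .inl ((h.eq_top_iff 0).mpr rfl)
  · obtain ⟨m, hm⟩ := h.values x hx
    exact .inr ⟨_, hm⟩

theorem valNorm_le_exp_iff (x : K) (M : ℝ) : valNorm ν x ≤ Real.exp (-M) ↔ (M : EReal) ≤ ν x := by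
  rcases h.eq_top_or_coe x with hx | ⟨a, ha⟩
  · simp [valNorm_of_eq_top hx, hx, Real.exp_nonneg]
  · simp [valNorm_of_eq_coe ha, ha]

theorem valNorm_lt_exp_iff (x : K) (M : ℝ) : valNorm ν x < Real.exp (-M) ↔ (M : EReal) < ν x := by
  rcases h.eq_top_or_coe x with hx | ⟨a, ha⟩
  · simp [valNorm_of_eq_top hx, hx, Real.exp_pos, EReal.coe_lt_top]
  · simp [valNorm_of_eq_coe ha, ha]

theorem valNorm_eq_exp_iff (x : K) (M : ℝ) : valNorm ν x = Real.exp (-M) ↔ ν x = (M : EReal) := by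
  rcases h.eq_top_or_coe x with hx | ⟨a, ha⟩
  · simp [valNorm_of_eq_top hx, hx, (Real.exp_ne_zero _).symm]
  · simp [valNorm_of_eq_coe ha, ha]

theorem valNorm_le_one_iff (x : K) : valNorm ν x ≤ 1 ↔ 0 ≤ ν x := by
  simpa using h.valNorm_le_exp_iff x 0

theorem valNorm_lt_one_iff (x : K) : valNorm ν x < 1 ↔ 0 < ν x := by
  simpa using h.valNorm_lt_exp_iff x 0

theorem valNorm_eq_zero_iff (x : K) : valNorm ν x = 0 ↔ x = 0 := by
  rw [← h.eq_top_iff]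
  rcases h.eq_top_or_coe x with hx | ⟨a, ha⟩
  · simp [valNorm_of_eq_top hx, hx]
  · simp [valNorm_of_eq_coe ha, ha, Real.exp_ne_zero]

theorem valNorm_mul (x y : K) : valNorm ν (x * y) = valNorm ν x * valNorm ν y := by
  rcases eq_or_ne x 0 with rfl | hx
  · rw [zero_mul, (h.valNorm_eq_zero_iff 0).mpr rfl, zero_mul]
  rcases eq_or_ne y 0 with rfl | hy
  · rw [mul_zero, (h.valNorm_eq_zero_iff 0).mpr rfl, mul_zero]
  obtain ⟨m, hm⟩ := h.values x hx
  obtain ⟨n, hn⟩ := h.values y hy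
  have hxy : ν (x * y) = ((m / e + n / e : ℝ) : EReal) := by
    rw [h.map_mul, hm, hn, EReal.coe_add]
  rw [valNorm_of_eq_coe hm, valNorm_of_eq_coe hn, valNorm_of_eq_coe hxy, neg_add, Real.exp_add]

theorem valNorm_add_le_max (x y : K) :
    valNorm ν (x + y) ≤ max (valNorm ν x) (valNorm ν y) := by
  have key : ∀ z : K, ν z ≤ ν (x + y) → valNorm ν (x + y) ≤ valNorm ν z := by
    intro z hz
    rcases h.eq_top_or_coe z with hz' | ⟨a, ha⟩
    · rw [hz', top_le_iff] at hz
      rw [valNorm_of_eq_top hz', valNorm_of_eq_top hz]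
    · rwa [valNorm_of_eq_coe ha, h.valNorm_le_exp_iff, ← ha]
  rcases min_le_iff.mp (h.min_le_add x y) with hx | hy
  · exact le_max_of_le_left (key x hx)
  · exact le_max_of_le_right (key y hy)

/-- The absolute value attached to a local valuation. -/
def absoluteValue : AbsoluteValue K ℝ where
  toFun := valNorm ν
  map_mul' := h.valNorm_mul
  nonneg' := valNorm_nonneg ν
  eq_zero' := h.valNorm_eq_zero_iff
  add_le' x y := (h.valNorm_add_le_max x y).trans
    (max_le_add_of_nonneg (valNorm_nonneg ν x) (valNorm_nonneg ν y))

end IsLocalValuation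

section Normed

variable {K : Type*} [NormedField K] {ν : K → EReal} {e q : ℕ}
  (h : IsLocalValuation K ν e q) (hn : ∀ x : K, ‖x‖ = valNorm ν x)

include h hn

theorem IsLocalValuation.isUltrametricDist : IsUltrametricDist K :=
  IsUltrametricDist.isUltrametricDist_of_forall_norm_add_le_max_norm fun x y => by
    simpa only [hn] using h.valNorm_add_le_max x y

theorem IsLocalValuation.completeSpace : CompleteSpace K := by
  refine Metric.complete_of_cauchySeq_tendsto fun u hu => ?_
  rw [Metric.cauchySeq_iff] at hu
  obtain ⟨l, hl⟩ := h.complete u fun M => by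
    obtain ⟨N, hN⟩ := hu (Real.exp (-M)) (Real.exp_pos _)
    refine ⟨N, fun m hm n hn' => ?_⟩
    rw [← h.valNorm_le_exp_iff, ← hn, ← dist_eq_norm]
    exact (hN m hm n hn').le
  refine ⟨l, Metric.tendsto_atTop.mpr fun ε hε => ?_⟩
  obtain ⟨N, hN⟩ := hl (-Real.log (ε / 2))
  refine ⟨N, fun n hn' => ?_⟩
  have := hN n hn'
  rw [← h.valNorm_le_exp_iff, ← hn, ← dist_eq_norm, neg_neg, Real.exp_log (by positivity)] at this
  linarith

theorem IsLocalValuation.card_normResidue [IsUltrametricDist K] :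
    Nat.card (normResidue K) = q := by
  obtain ⟨s, hs, hs0, hsx⟩ := h.residue
  refine _root_.card_normResidue s hs (fun y hy => ?_) fun x hx => ?_
  · rw [hn, h.valNorm_le_one_iff]
    exact hs0 y hy
  · rw [hn, h.valNorm_le_one_iff] at hx
    simpa only [hn, h.valNorm_lt_one_iff] using hsx x hx

theorem IsLocalValuation.exists_norm_eq_exp :
    ∃ π : K, ‖π‖ = Real.exp (-(e : ℝ)⁻¹) ∧ ∀ x : K, x ≠ 0 → ∃ m : ℤ, ‖x‖ = ‖π‖ ^ m := by
  obtain ⟨π, hπ⟩ := h.exists_uniformizer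
  have hπ' : ‖π‖ = Real.exp (-(e : ℝ)⁻¹) := by rw [hn, valNorm_of_eq_coe hπ]
  refine ⟨π, hπ', fun x hx => ?_⟩
  obtain ⟨m, hm⟩ := h.values x hx
  refine ⟨m, ?_⟩
  rw [hn, valNorm_of_eq_coe hm, hπ', ← Real.rpow_intCast, ← Real.exp_mul]
  congr 1
  ring

end Normed

end LocalValuation

section Main

open Module

theorem IntermediateField.sup_eq_top_of_coprime {k E : Type*} [Field k] [Field E] [Algebra k E]
    [FiniteDimensional k E] (T L : IntermediateField k E)
    (h : Nat.Coprime (finrank k T) (finrank k L))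
    (hTL : finrank k T * finrank k L = finrank k E) : T ⊔ L = ⊤ := by
  refine IntermediateField.eq_of_le_of_finrank_le le_top ?_
  rw [IntermediateField.finrank_top', ← hTL]
  exact Nat.le_of_dvd finrank_pos (h.mul_dvd_of_dvd_of_dvd
    (IntermediateField.finrank_dvd_of_le_right le_sup_left)
    (IntermediateField.finrank_dvd_of_le_right le_sup_right))

theorem exists_norm_eq_of_coprime {k E : Type*} [NontriviallyNormedField k] [NormedField E]
    [NormedAlgebra k E] [CompleteSpace k] [IsUltrametricDist k] [IsUltrametricDist E]
    [FiniteDimensional k E] (T : IntermediateField k E) {ϖ : k} {ω : E} {e : ℕ}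
    (hω : ω ≠ 0) (hϖ : ‖ϖ‖ = ‖ω‖ ^ e) (h : Nat.Coprime (finrank T E) e) : ∃ π ∈ T, ‖π‖ = ‖ω‖ := by
  obtain ⟨d, hd, y, hyT, hy⟩ := exists_norm_eq_pow (k := k) T ω
  obtain ⟨a, b, hab⟩ := Nat.isCoprime_iff_coprime.mpr (h.coprime_dvd_left hd)
  refine ⟨y ^ a * algebraMap k E ϖ ^ b,
    T.mul_mem (zpow_mem hyT a) (zpow_mem (T.algebraMap_mem ϖ) b), ?_⟩
  have hω' : ‖ω‖ ≠ 0 := norm_ne_zero_iff.mpr hω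
  rw [norm_mul, norm_zpow, norm_zpow, norm_algebraMap', hy, hϖ, ← zpow_natCast, ← zpow_natCast,
    ← zpow_mul, ← zpow_mul, ← zpow_add₀ hω', mul_comm _ a, mul_comm _ b, hab, zpow_one]

/-- The equivalences for a finite extension of complete normed fields whose norms come from
local valuations. -/
theorem tfae_of_norm {k E : Type*} [NontriviallyNormedField k] [NormedField E] [NormedAlgebra k E]
    [FiniteDimensional k E]
    (νk : k → EReal) (νE : E → EReal) (e f q qE : ℕ)
    (hk : IsLocalValuation k νk 1 q) (hE : IsLocalValuation E νE e qE)
    (hnk : ∀ x : k, ‖x‖ = valNorm νk x) (hnE : ∀ x : E, ‖x‖ = valNorm νE x)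
    (hdeg : Module.finrank k E = e * f) (hresdeg : qE = q ^ f)
    (hcop : Nat.Coprime e f)
    (Eur : IntermediateField k E)
    (hEur_unr : ∀ x : Eur, (x : E) ≠ 0 → ∃ m : ℤ, νE (x : E) = ((m : ℝ) : EReal))
    (hEur_deg : Module.finrank k Eur = f) :
    List.TFAE
      [(∃ ψ : E ≃ₐ[k] E, (∀ x ∈ Eur, ψ x ∈ Eur) ∧
          ∀ x ∈ Eur, 0 ≤ νE x → 0 < νE (ψ x - x ^ q)),
        f ∣ Nat.card (E ≃ₐ[k] E),
        (∃ act : Multiplicative (ZMod f) →* MulAut (↥Eur.fixingSubgroup),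
          Nonempty ((E ≃ₐ[k] E) ≃*
            SemidirectProduct (↥Eur.fixingSubgroup) (Multiplicative (ZMod f)) act)),
        (∃ H : Subgroup (E ≃ₐ[k] E), Nat.card H = f),
        (∃ E' : IntermediateField k E, Module.finrank k E' = e),
        (∃ T L : IntermediateField k E,
          (∃ π : T, νE (π : E) = (((Module.finrank k T : ℝ)⁻¹ : ℝ) : EReal)) ∧
          (∀ x : L, (x : E) ≠ 0 → ∃ m : ℤ, νE (x : E) = ((m : ℝ) : EReal)) ∧
          Module.finrank k T * Module.finrank k L = Module.finrank k E ∧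
          T ⊔ L = ⊤)] := by
  have := hk.isUltrametricDist hnk
  have := hE.isUltrametricDist hnE
  have := hk.completeSpace hnk
  have he0 : 0 < e := hE.e_pos
  have hf0 : 0 < f := hEur_deg ▸ finrank_pos
  have hcardk := hk.card_normResidue hnk
  have hcardE := hE.card_normResidue hnE
  have : Finite (normResidue k) :=
    Nat.finite_of_card_ne_zero (by have := hk.one_lt_q; omega)
  have : Finite (normResidue E) :=
    Nat.finite_of_card_ne_zero (by have := hE.one_lt_q; omega)
  have hresf : finrank (normResidue k) (normResidue E) = f := by
    refine Nat.pow_right_injective hk.one_lt_q ?_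
    change q ^ _ = q ^ _
    rw [← hresdeg, ← hcardE, ← hcardk,
      Module.natCard_eq_pow_finrank (K := normResidue k) (V := normResidue E)]
  have hΓ : Nat.card (normResidue E ≃ₐ[normResidue k] normResidue E) = f := by
    rw [IsGalois.card_aut_eq_finrank, hresf]
  obtain ⟨ϖ, hϖ, -⟩ := hk.exists_norm_eq_exp hnk
  obtain ⟨ω, hω, hval⟩ := hE.exists_norm_eq_exp hnE
  have hϖ0 : ϖ ≠ 0 := norm_ne_zero_iff.mp (hϖ ▸ Real.exp_ne_zero _)
  have hω0 : ω ≠ 0 := norm_ne_zero_iff.mp (hω ▸ Real.exp_ne_zero _)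
  have hϖ1 : ‖ϖ‖ < 1 := by rw [hϖ]; simp
  have hω1 : ‖ω‖ < 1 := by rw [hω]; simpa using he0
  have hϖω : ‖ϖ‖ = ‖ω‖ ^ e := by
    rw [hϖ, hω, ← Real.exp_nat_mul]
    congr 1
    field_simp
    simp
  have hdisc : ∀ x : E, ‖x‖ < 1 → ‖x‖ ≤ ‖ω‖ := by
    intro x hx
    rcases eq_or_ne x 0 with rfl | hx0
    · simp
    obtain ⟨m, hm⟩ := hval x hx0
    rw [hm] at hx ⊢
    have hm0 : 0 < m := by
      by_contra! hm0
      exact hx.not_ge (one_le_zpow_of_nonpos₀ (norm_pos_iff.mpr hω0) hω1.le hm0)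
    simpa using zpow_le_zpow_right_of_le_one₀ (norm_pos_iff.mpr hω0) hω1.le
      (show (1 : ℤ) ≤ m by omega)
  have hunr : ∀ L : IntermediateField k E,
      (∀ x : L, (x : E) ≠ 0 → ∃ m : ℤ, νE (x : E) = ((m : ℝ) : EReal)) →
      ∀ x ∈ L, x ≠ 0 → ∃ m : ℤ, ‖x‖ = ‖ϖ‖ ^ m := by
    intro L hL x hx hx0
    obtain ⟨m, hm⟩ := hL ⟨x, hx⟩ hx0
    refine ⟨m, ?_⟩
    rw [hnE, valNorm_of_eq_coe hm, hϖ, ← Real.rpow_intCast, ← Real.exp_mul]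
    simp
  have hur : ∀ L : IntermediateField k E,
      (∀ x : L, (x : E) ≠ 0 → ∃ m : ℤ, νE (x : E) = ((m : ℝ) : EReal)) → f ≤ finrank k L →
      finrank k L = f ∧ L = teichmullerField k E := by
    intro L hL hfL
    obtain ⟨h1, h2⟩ := finrank_eq_of_unramified hϖ0 hϖ1 (hunr L hL) (hresf ▸ hfL)
    exact ⟨h1.trans hresf, eq_teichmullerField_of_unramified hω1 hdisc hϖ0 hϖ1 (hunr L hL) h2⟩
  have hEur := (hur Eur hEur_unr hEur_deg.ge).2
  have hfinEur : finrank Eur E = e := by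
    have := finrank_mul_finrank k Eur E
    rw [hEur_deg, hdeg, mul_comm e] at this
    exact Nat.eq_of_mul_eq_mul_left hf0 this
  have hN : Nat.Coprime (Nat.card Eur.fixingSubgroup) f := by
    refine hcop.coprime_dvd_left ?_
    rw [← IntermediateField.finrank_fixedField_eq_card, ← hfinEur]
    exact IntermediateField.finrank_dvd_of_le_left
      (IntermediateField.le_iff_le _ _ |>.mpr le_rfl)
  have hker : (normResidueAut (k := k) (E := E)).ker = Eur.fixingSubgroup := by
    rw [hEur, ker_normResidueAut hω1 hdisc]
  tfae_have 1 ↔ 2 := by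
    have hsurj := MonoidHom.surjective_iff_card_dvd (normResidueAut (k := k) (E := E))
      (by rwa [hker, hΓ])
    rw [hΓ, ← exists_frobenius_iff_surjective hω1 hdisc, ← hEur, hcardk] at hsurj
    simpa only [hnE, hE.valNorm_le_one_iff, hE.valNorm_lt_one_iff] using hsurj
  tfae_have 2 → 3 := fun h =>
    MonoidHom.exists_mulEquiv_semidirectProduct _ hΓ hker hN
      ((MonoidHom.surjective_iff_card_dvd _ (by rwa [hker, hΓ])).mpr (by rwa [hΓ]))
  tfae_have 3 → 4 := by
    rintro ⟨act, ⟨i⟩⟩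
    obtain ⟨S, hS⟩ := SemidirectProduct.exists_subgroup_card_eq i
    exact ⟨S, by rw [hS, Nat.card_congr Multiplicative.toAdd, Nat.card_zmod]⟩
  tfae_have 4 → 2 := by
    rintro ⟨H, rfl⟩
    exact Subgroup.card_subgroup_dvd_card H
  tfae_have 4 → 5 := by
    rintro ⟨H, hH⟩
    refine ⟨IntermediateField.fixedField H, Nat.eq_of_mul_eq_mul_right hf0 ?_⟩
    rw [← hdeg, ← hH, ← IntermediateField.finrank_fixedField_eq_card, finrank_mul_finrank]
  tfae_have 5 → 6 := by
    rintro ⟨T, hT⟩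
    have hTE : finrank T E = f := by
      refine Nat.eq_of_mul_eq_mul_left he0 ?_
      rw [← hdeg, ← hT, finrank_mul_finrank]
    obtain ⟨π, hπT, hπ⟩ := exists_norm_eq_of_coprime T hω0 hϖω (by rw [hTE]; exact hcop.symm)
    refine ⟨T, Eur, ⟨⟨π, hπT⟩, ?_⟩, hEur_unr, by rw [hT, hEur_deg, hdeg], ?_⟩
    · rw [hT, ← hE.valNorm_eq_exp_iff, ← hnE, hπ, hω]
    · exact IntermediateField.sup_eq_top_of_coprime T Eur (by rwa [hT, hEur_deg])
        (by rw [hT, hEur_deg, hdeg])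
  tfae_have 6 → 4 := by
    rintro ⟨T, L, ⟨π, hπ⟩, hL, hTL, hsup⟩
    have ht0 : 0 < finrank k T := finrank_pos
    have hπ0 : (π : E) ≠ 0 := fun h0 =>
      EReal.coe_ne_top _ (hπ.symm.trans ((hE.eq_top_iff _).mpr h0))
    obtain ⟨m, hm⟩ := hE.values π hπ0
    rw [hπ, EReal.coe_eq_coe_iff] at hm
    have hte : (e : ℤ) = m * finrank k T := by
      have : (e : ℝ) = m * finrank k T := by
        field_simp at hm
        linarith
      exact_mod_cast this
    lift m to ℕ using by
      by_contra! hm0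
      have : m * finrank k T < 0 := mul_neg_of_neg_of_pos hm0 (by exact_mod_cast ht0)
      omega
    have hte' : e = m * finrank k T := by exact_mod_cast hte
    have hfL : finrank k L = m * f := by
      refine Nat.eq_of_mul_eq_mul_left ht0 ?_
      rw [hTL, hdeg, hte']
      ring
    have hm0 : 0 < m := Nat.pos_of_ne_zero (by rintro rfl; simp at hte'; omega)
    obtain ⟨hLf, hLU⟩ := hur L hL (hfL ▸ Nat.le_mul_of_pos_left f hm0)
    have := isGalois_of_sup_teichmullerField hω1 hdisc T (hLU ▸ hsup)
    refine ⟨T.fixingSubgroup, ?_⟩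
    rw [Nat.card_congr (IntermediateField.fixingSubgroupEquiv T).toEquiv,
      IsGalois.card_aut_eq_finrank]
    refine Nat.eq_of_mul_eq_mul_left ht0 ?_
    rw [finrank_mul_finrank, ← hTL, hLf]
  tfae_finish

end Main

/-- Let `E|k` be a finite extension of non-Archimedean local fields
with `e = e(E|k)` and `f = f(E|k)` coprime, and let `Eur` be the maximal unramified
subextension.  Then the following are equivalent:
1. the Frobenius of `Eur|k` extends to a `k`-algebra automorphism of `E`
   (the strong extension property);
2. `f` divides `#Aut(E|k)`;
3. `Aut(E|k)` is isomorphic to a semidirect product `Aut(E|E_ur) ⋊ ℤ/fℤ`;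
4. `Aut(E|k)` has a subgroup of order `f`;
5. there is an intermediate field `E′` of `E|k` with `[E′:k] = e`;
6. `E` is `k`-algebra isomorphic to a tensor product of a totally ramified and an
   unramified extension of `k` (equivalently, there are intermediate fields `T`, `L`
   of `E|k`, `T` totally ramified and `L` unramified over `k`, with
   `[T:k]·[L:k] = [E:k]` and compositum `E`). -/
theorem stmt_4
    {k E : Type*} [Field k] [Field E] [Algebra k E] [FiniteDimensional k E]
    (νk : k → EReal) (νE : E → EReal) (e f q qE : ℕ)
    (hk : IsLocalValuation k νk 1 q) (hE : IsLocalValuation E νE e qE)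
    (hcompat : ∀ c : k, νE (algebraMap k E c) = νk c)
    (hdeg : Module.finrank k E = e * f) (hresdeg : qE = q ^ f)
    (hcop : Nat.Coprime e f)
    (Eur : IntermediateField k E)
    (hEur_unr : ∀ x : Eur, (x : E) ≠ 0 → ∃ m : ℤ, νE (x : E) = ((m : ℝ) : EReal))
    (hEur_deg : Module.finrank k Eur = f) :
    List.TFAE
      [(∃ ψ : E ≃ₐ[k] E, (∀ x ∈ Eur, ψ x ∈ Eur) ∧
          ∀ x ∈ Eur, 0 ≤ νE x → 0 < νE (ψ x - x ^ q)),
        f ∣ Nat.card (E ≃ₐ[k] E),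
        (∃ act : Multiplicative (ZMod f) →* MulAut (↥Eur.fixingSubgroup),
          Nonempty ((E ≃ₐ[k] E) ≃*
            SemidirectProduct (↥Eur.fixingSubgroup) (Multiplicative (ZMod f)) act)),
        (∃ H : Subgroup (E ≃ₐ[k] E), Nat.card H = f),
        (∃ E' : IntermediateField k E, Module.finrank k E' = e),
        (∃ T L : IntermediateField k E,
          (∃ π : T, νE (π : E) = (((Module.finrank k T : ℝ)⁻¹ : ℝ) : EReal)) ∧
          (∀ x : L, (x : E) ≠ 0 → ∃ m : ℤ, νE (x : E) = ((m : ℝ) : EReal)) ∧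
          Module.finrank k T * Module.finrank k L = Module.finrank k E ∧
          T ⊔ L = ⊤)] := by
  let _ : NormedField k := hk.absoluteValue.toNormedField
  let _ : NormedField E := hE.absoluteValue.toNormedField
  have hnk : ∀ x : k, ‖x‖ = valNorm νk x := fun _ => rfl
  have hnE : ∀ x : E, ‖x‖ = valNorm νE x := fun _ => rfl
  let _ : NontriviallyNormedField k := NontriviallyNormedField.ofNormNeOne (by
    obtain ⟨ϖ, hϖ, -⟩ := hk.exists_norm_eq_exp hnk
    refine ⟨ϖ, norm_ne_zero_iff.mp (hϖ ▸ Real.exp_ne_zero _), ?_⟩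
    rw [hϖ]
    simp)
  let _ : NormedAlgebra k E :=
    { (inferInstance : Algebra k E) with
      norm_smul_le := fun c x => by
        rw [Algebra.smul_def, norm_mul, hnE (algebraMap k E c), hnk]
        simp only [valNorm, hcompat, le_refl] }
  exact tfae_of_norm νk νE e f q qE hk hE hnk hnE hdeg hresdeg hcop Eur hEur_unr hEur_deg
end
end
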